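/- arXiv:math/0607659 — 4 statements merged into one kernel-verified Lean document; each statement's English description precedes it below -/
import Mathlib

section
/- Let n ≥ 1, let j ≥ 0 be an integer, let N₀ > n and C > 0. Suppose that for each m = (k,l) ∈ ℤⁿ × ℤⁿ, T_{j,m} is a bounded linear operator on L²(ℝⁿ) with adjoint T*_{j,m}, satisfying: (a) ‖T_{j,m}‖ ≤ C for all m; (b) ‖T_{j,k₁,l₁} T*_{j,k₂,l₂}‖ ≤ C (1+4^{−j}|k₁−k₂|)^{−2N₀} (1+|l₁−l₂|)^{−2N₀} for all k₁,k₂,l₁,l₂ ∈ ℤⁿ; (c) ‖T*_{j,k₁,l₁} T_{j,k₂,l₂}‖ ≤ C (1+|k₁−k₂|)^{−2N₀} (1+4^{−j}|l₁−l₂|)^{−2N₀} for all k₁,k₂,l₁,l₂ ∈ ℤⁿ. Then for every f ∈ L²(ℝⁿ) the series ∑_{m∈ℤ^{2n}} T_{j,m} f converges in L²(ℝⁿ), and the resulting operator T_j = ∑_{m} T_{j,m} is bounded on L²(ℝⁿ) with ‖T_j‖ ≤ C′ · 4^{jn}, where C′ depends only on C, N₀ and n. -/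
open MeasureTheory ContinuousLinearMap

noncomputable section

abbrev En (n : ℕ) : Type := EuclideanSpace ℝ (Fin n)

abbrev L2 (n : ℕ) := MeasureTheory.Lp ℂ 2 (volume : Measure (En n))

/-- Image of an integer vector `k ∈ ℤⁿ` in `ℝⁿ`. -/
def intVec (n : ℕ) (k : Fin n → ℤ) : En n :=
  (EuclideanSpace.equiv (Fin n) ℝ).symm fun i => (k i : ℝ)

section CS
variable {ι H : Type*} [NormedAddCommGroup H] [InnerProductSpace ℂ H] [CompleteSpace H]

lemma cs_step (T : ι → H →L[ℂ] H) (a b : ι → ι → ℝ) (A M : ℝ) (s : Finset ι)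
    (hA : 0 ≤ A) (hM : 0 ≤ M) (ha0 : ∀ i j, 0 ≤ a i j) (hb0 : ∀ i j, 0 ≤ b i j)
    (hT : ∀ i, ‖T i‖ ≤ M ^ 2)
    (ha : ∀ i j, ‖T i * star (T j)‖ ≤ a i j ^ 2)
    (hb : ∀ i j, ‖star (T i) * T j‖ ≤ b i j ^ 2)
    (hsa : ∀ i, ∑ j ∈ s, a i j ≤ A) (hsb : ∀ i, ∑ j ∈ s, b i j ≤ A) (m : ℕ) :
    ∀ (V : H →L[ℂ] H) (i : ι) (p q : ℝ), 0 ≤ p → 0 ≤ q → ‖V * T i‖ ≤ p ^ 2 → ‖V‖ ≤ q ^ 2 →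
      ‖V * T i * (star (∑ k ∈ s, T k) * ∑ k ∈ s, T k) ^ m‖ ≤ M * p * q * A ^ (2 * m) := by
  induction m with
  | zero =>
    intro V i p q hp hq h1 h2
    simp only [pow_zero, mul_one, mul_zero]
    have h3 : ‖V * T i‖ ≤ q ^ 2 * M ^ 2 :=
      (norm_mul_le _ _).trans (mul_le_mul h2 (hT i) (norm_nonneg _) (by positivity))
    have h4 : ‖V * T i‖ ^ 2 ≤ (M * p * q) ^ 2 := by
      calc ‖V * T i‖ ^ 2 = ‖V * T i‖ * ‖V * T i‖ := by ring
        _ ≤ p ^ 2 * (q ^ 2 * M ^ 2) := mul_le_mul h1 h3 (norm_nonneg _) (by positivity)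
        _ = _ := by ring
    exact le_of_sq_le_sq h4 (by positivity)
  | succ m ih =>
    intro V i p q hp hq h1 h2
    set P := (star (∑ k ∈ s, T k) * ∑ k ∈ s, T k) ^ m with hP
    have e : V * T i * (star (∑ k ∈ s, T k) * ∑ k ∈ s, T k) ^ (m + 1)
        = ∑ k ∈ s, ∑ l ∈ s, (V * T i * star (T k)) * T l * P := by
      rw [pow_succ', ← hP, star_sum, Finset.sum_mul_sum]
      simp only [Finset.sum_mul, Finset.mul_sum, mul_assoc]
    rw [e]
    calc _ ≤ ∑ k ∈ s, ∑ l ∈ s, M * (p * b k l) * (q * a i k) * A ^ (2 * m) := by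
          refine norm_sum_le_of_le _ fun k _ => norm_sum_le_of_le _ fun l _ => ?_
          refine ih _ l _ _ (mul_nonneg hp (hb0 _ _)) (mul_nonneg hq (ha0 _ _)) ?_ ?_
          · rw [mul_assoc (V * T i), mul_pow]
            exact (norm_mul_le _ _).trans (mul_le_mul h1 (hb k l) (norm_nonneg _) (by positivity))
          · rw [mul_assoc V, mul_pow]
            exact (norm_mul_le _ _).trans (mul_le_mul h2 (ha i k) (norm_nonneg _) (by positivity))
      _ = ∑ k ∈ s, (M * p * q * A ^ (2 * m)) * (a i k * ∑ l ∈ s, b k l) := by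
          simp only [Finset.mul_sum]
          refine Finset.sum_congr rfl fun k _ => Finset.sum_congr rfl fun l _ => by ring
      _ ≤ ∑ k ∈ s, (M * p * q * A ^ (2 * m)) * (a i k * A) := by
          refine Finset.sum_le_sum fun k _ => ?_
          exact mul_le_mul_of_nonneg_left (mul_le_mul_of_nonneg_left (hsb k) (ha0 _ _))
            (by positivity)
      _ = (M * p * q * A ^ (2 * m)) * A * ∑ k ∈ s, a i k := by
          rw [Finset.mul_sum]; exact Finset.sum_congr rfl fun k _ => by ring
      _ ≤ (M * p * q * A ^ (2 * m)) * A * A :=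
          mul_le_mul_of_nonneg_left (hsa i) (by positivity)
      _ = _ := by ring

lemma cs_finite (T : ι → H →L[ℂ] H) (a b : ι → ι → ℝ) (A M : ℝ) (s : Finset ι)
    (hA : 0 < A) (hM : 0 ≤ M) (ha0 : ∀ i j, 0 ≤ a i j) (hb0 : ∀ i j, 0 ≤ b i j)
    (hT : ∀ i, ‖T i‖ ≤ M ^ 2)
    (ha : ∀ i j, ‖T i * star (T j)‖ ≤ a i j ^ 2)
    (hb : ∀ i j, ‖star (T i) * T j‖ ≤ b i j ^ 2)
    (hsa : ∀ i, ∑ j ∈ s, a i j ≤ A) (hsb : ∀ i, ∑ j ∈ s, b i j ≤ A) :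
    ‖∑ k ∈ s, T k‖ ≤ A := by
  set S := ∑ k ∈ s, T k with hS
  by_contra! hlt
  have hSpos : 0 < ‖S‖ := hA.trans hlt
  have key : ∀ m : ℕ, ‖S * (star S * S) ^ m‖ ≤ s.card * (M * M) * A ^ (2 * m) := by
    intro m
    have e : S * (star S * S) ^ m = ∑ i ∈ s, 1 * T i * (star S * S) ^ m := by
      conv_lhs => rw [hS]
      rw [Finset.sum_mul]; simp only [one_mul]; rfl
    rw [e]
    calc _ ≤ ∑ i ∈ s, M * M * 1 * A ^ (2 * m) := by
          refine norm_sum_le_of_le _ fun i _ => ?_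
          refine cs_step T a b A M s hA.le hM ha0 hb0 hT ha hb hsa hsb m 1 i M 1 hM zero_le_one
            (by simpa using hT i) ?_
          rw [one_pow]; exact ContinuousLinearMap.norm_id_le (𝕜 := ℂ) (E := H)
      _ = _ := by simp; ring
  have hsa : IsSelfAdjoint (star S * S) := IsSelfAdjoint.star_mul_self S
  have hpow : ∀ k : ℕ, ‖(star S * S) ^ 2 ^ k‖ = (‖S‖ ^ 2) ^ 2 ^ k := by
    intro k
    have := congrArg NNReal.toReal (hsa.nnnorm_pow_two_pow k)
    simp only [coe_nnnorm, NNReal.coe_pow] at this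
    rw [this, CStarRing.norm_star_mul_self]; ring
  have hbd : ∀ k : ℕ, ((‖S‖ / A) ^ 2) ^ 2 ^ k ≤ s.card * (M * M) * ‖S‖ / A ^ 2 := by
    intro k
    obtain ⟨m, hm⟩ : ∃ m, 2 ^ k = m + 1 := ⟨2 ^ k - 1, by have := Nat.one_le_two_pow (n := k); omega⟩
    have h1 : (‖S‖ ^ 2) ^ 2 ^ k ≤ ‖S‖ * (s.card * (M * M) * A ^ (2 * m)) := by
      rw [← hpow, hm, pow_succ', mul_assoc]
      refine (norm_mul_le _ _).trans ?_
      rw [norm_star]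
      exact mul_le_mul_of_nonneg_left (key m) (norm_nonneg _)
    rw [div_pow, div_pow, div_le_div_iff₀ (by positivity) (by positivity)]
    calc _ ≤ ‖S‖ * (s.card * (M * M) * A ^ (2 * m)) * A ^ 2 :=
          mul_le_mul_of_nonneg_right h1 (by positivity)
      _ = _ := by rw [hm]; ring
  have hr : 1 < (‖S‖ / A) ^ 2 := one_lt_pow₀ ((one_lt_div hA).2 hlt) two_ne_zero
  obtain ⟨N, hN⟩ := pow_unbounded_of_one_lt (s.card * (M * M) * ‖S‖ / A ^ 2) hr
  have := pow_le_pow_right₀ hr.le (Nat.lt_two_pow_self (n := N)).le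
  linarith [hbd N]

lemma cs_main (T : ι → H →L[ℂ] H) (a b : ι → ι → ℝ) (A M : ℝ)
    (hA : 0 < A) (hM : 0 ≤ M) (ha0 : ∀ i j, 0 ≤ a i j) (hb0 : ∀ i j, 0 ≤ b i j)
    (hT : ∀ i, ‖T i‖ ≤ M ^ 2)
    (ha : ∀ i j, ‖T i * star (T j)‖ ≤ a i j ^ 2)
    (hb : ∀ i j, ‖star (T i) * T j‖ ≤ b i j ^ 2)
    (hsa : ∀ i (s : Finset ι), ∑ j ∈ s, a i j ≤ A)
    (hsb : ∀ i (s : Finset ι), ∑ j ∈ s, b i j ≤ A) :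
    ∃ S : H →L[ℂ] H, (∀ f, HasSum (fun q => T q f) (S f)) ∧ ‖S‖ ≤ A := by
  have hfin : ∀ (s : Finset ι) (f : H), ‖∑ k ∈ s, T k f‖ ≤ A * ‖f‖ := by
    intro s f
    have h := cs_finite T a b A M s hA hM ha0 hb0 hT ha hb (fun i => hsa i s) (fun i => hsb i s)
    have := (∑ k ∈ s, T k).le_of_opNorm_le h f
    simpa using this
  let G : Submodule ℂ H :=
    { carrier := {f | Summable fun q => T q f}
      zero_mem' := by simpa using summable_zero
      add_mem' := by
        intro f g hf hg
        simpa using Summable.add hf hg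
      smul_mem' := by
        intro c f hf
        simpa using Summable.const_smul c hf }
  have hmem : ∀ f, f ∈ G ↔ Summable fun q => T q f := fun f => Iff.rfl
  have hclosed : IsClosed (G : Set H) := by
    refine isClosed_of_closure_subset fun f hf => ?_
    change Summable _
    rw [summable_iff_vanishing_norm]
    intro ε hε
    obtain ⟨g, hg, hfg⟩ := Metric.mem_closure_iff.1 hf (ε / (2 * A)) (by positivity)
    obtain ⟨s, hs⟩ := summable_iff_vanishing_norm.1 ((hmem g).1 hg) (ε / 2) (by positivity)
    refine ⟨s, fun t ht => ?_⟩
    have e : ∑ i ∈ t, T i f = ∑ i ∈ t, T i (f - g) + ∑ i ∈ t, T i g := by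
      rw [← Finset.sum_add_distrib]; simp
    rw [e]
    have h1 := hfin t (f - g)
    rw [dist_eq_norm, lt_div_iff₀ (by positivity)] at hfg
    have h2 := hs t ht
    have h3 := norm_add_le (∑ i ∈ t, T i (f - g)) (∑ i ∈ t, T i g)
    linarith
  have hrange : ∀ p g, star (T p) g ∈ G := by
    intro p g
    rw [hmem]
    have hs : Summable (fun q => a p q) := summable_of_sum_le (ha0 p) (hsa p)
    refine Summable.of_norm_bounded (hs.mul_left (A * ‖g‖)) fun q => ?_
    have h1 : ‖T q * star (T p)‖ ≤ a p q ^ 2 := by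
      rw [← norm_star, star_mul, star_star]; exact ha p q
    have h2 : a p q ≤ A := by simpa using hsa p {q}
    have h3 := (T q * star (T p)).le_of_opNorm_le h1 g
    refine h3.trans ?_
    have := mul_le_mul_of_nonneg_right h2 (ha0 p q)
    nlinarith [norm_nonneg g]
  have horth : Gᗮ ≤ G := by
    intro f hf
    rw [hmem]
    have : ∀ q, T q f = 0 := by
      intro q
      have := (Submodule.mem_orthogonal G f).1 hf _ (hrange q (T q f))
      rw [ContinuousLinearMap.star_eq_adjoint, ContinuousLinearMap.adjoint_inner_left] at this
      simpa using this
    simpa [this] using summable_zero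
  have htop : G = ⊤ := by
    have : CompleteSpace G := hclosed.completeSpace_coe
    rw [← Submodule.orthogonal_eq_bot_iff, eq_bot_iff, ← G.inf_orthogonal_eq_bot]
    exact le_inf horth le_rfl
  have hsum : ∀ f, Summable fun q => T q f := fun f => (hmem f).1 (htop ▸ Submodule.mem_top)
  let L : H →ₗ[ℂ] H :=
    { toFun := fun f => ∑' q, T q f
      map_add' := fun f g => by
        simp only [map_add]; exact (hsum f).tsum_add (hsum g)
      map_smul' := fun c f => by
        simp only [map_smul, RingHom.id_apply]; exact (hsum f).tsum_const_smul c }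
  have hL : ∀ f, ‖L f‖ ≤ A * ‖f‖ := fun f =>
    le_of_tendsto (hsum f).hasSum.norm (Filter.Eventually.of_forall fun s => hfin s f)
  exact ⟨L.mkContinuous A hL, fun f => (hsum f).hasSum, L.mkContinuous_norm_le hA.le hL⟩
end CS

lemma summable_one_add_abs (σ : ℝ) (hσ : 1 < σ) :
    Summable fun z : ℤ => (1 + |(z : ℝ)|) ^ (-σ) := by
  have h := (Real.summable_abs_int_rpow hσ)
  have h2 : Summable fun z : ℤ => |(z : ℝ)| ^ (-σ) + (if z = 0 then 1 else 0) :=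
    h.add (summable_of_ne_finset_zero (s := {0}) (by intro b hb; simpa using hb))
  refine Summable.of_nonneg_of_le (fun z => by positivity) (fun z => ?_) h2
  by_cases hz : z = 0
  · subst hz
    have : (0 : ℝ) ≤ (0 : ℝ) ^ (-σ) := Real.rpow_nonneg le_rfl _
    simpa using this
  · simp only [hz, if_false, add_zero]
    have : 0 < |(z : ℝ)| := by positivity
    exact Real.rpow_le_rpow_of_nonpos this (by linarith) (by linarith)

lemma sum_one_dim (σ : ℝ) (hσ : 1 < σ) : ∃ D : ℝ, 0 < D ∧ ∀ (R : ℕ), 0 < R → ∀ s : Finset ℤ,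
    ∑ z ∈ s, (1 + (R : ℝ)⁻¹ * |(z : ℝ)|) ^ (-σ) ≤ D * R := by
  set g : ℤ → ℝ := fun z => (1 + |(z : ℝ)|) ^ (-σ) with hg
  have hgs : Summable g := summable_one_add_abs σ hσ
  have hg0 : ∀ z, 0 ≤ g z := fun z => by simp only [hg]; positivity
  refine ⟨2 ^ σ * (∑' z, g z + 1), ?_, ?_⟩
  · have : 0 ≤ ∑' z, g z := tsum_nonneg hg0
    positivity
  intro R hR s
  have : NeZero R := ⟨hR.ne'⟩
  have hRr : (0 : ℝ) < R := by exact_mod_cast hR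
  let e := Int.divModEquiv R
  have hpt : ∀ z : ℤ, (1 + (R : ℝ)⁻¹ * |(z : ℝ)|) ^ (-σ) ≤ 2 ^ σ * g (e z).1 := by
    intro z
    obtain ⟨⟨w, r⟩, rfl⟩ := e.symm.surjective z
    have hz : ((e.symm (w, r) : ℤ) : ℝ) = w * R + (r : ℕ) := by
      simp [e, Int.divModEquiv]
    rw [Equiv.apply_symm_apply, hz]
    have hr : ((r : ℕ) : ℝ) < R := by exact_mod_cast r.2
    have hr0 : (0 : ℝ) ≤ ((r : ℕ) : ℝ) := by positivity
    have h1 : |(w : ℝ)| * R ≤ |(w : ℝ) * R + (r : ℕ)| + R := by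
      have h2 : |(w : ℝ) * R| = |(w : ℝ)| * R := by rw [abs_mul, abs_of_pos hRr]
      have h3 : |(w : ℝ) * R| ≤ |(w : ℝ) * R + (r : ℕ)| + |((r : ℕ) : ℝ)| := by
        have := abs_sub ((w : ℝ) * R + (r : ℕ)) ((r : ℕ) : ℝ)
        simpa using this
      rw [abs_of_nonneg hr0] at h3
      linarith
    have h2 : |(w : ℝ)| ≤ (R : ℝ)⁻¹ * |(w : ℝ) * R + (r : ℕ)| + 1 := by
      have := mul_le_mul_of_nonneg_left h1 (inv_nonneg.2 hRr.le)
      rw [mul_add, inv_mul_cancel₀ hRr.ne', mul_comm |(w : ℝ)|, inv_mul_cancel_left₀ hRr.ne'] at this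
      exact this
    have h0 : 0 ≤ (R : ℝ)⁻¹ * |(w : ℝ) * R + (r : ℕ)| := by positivity
    have h3 : 2⁻¹ * (1 + |(w : ℝ)|) ≤ 1 + (R : ℝ)⁻¹ * |(w : ℝ) * R + (r : ℕ)| := by linarith
    refine (Real.rpow_le_rpow_of_nonpos (by positivity) h3 (by linarith)).trans (le_of_eq ?_)
    rw [Real.mul_rpow (by positivity) (by positivity), Real.inv_rpow (by norm_num),
      Real.rpow_neg (by norm_num : (0:ℝ) ≤ 2), inv_inv]
  calc _ ≤ ∑ z ∈ s, 2 ^ σ * g (e z).1 := Finset.sum_le_sum fun z _ => hpt z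
    _ = 2 ^ σ * ∑ p ∈ s.map e.toEmbedding, g p.1 := by
        rw [Finset.sum_map, Finset.mul_sum]; rfl
    _ ≤ 2 ^ σ * ∑ p ∈ ((s.map e.toEmbedding).image Prod.fst) ×ˢ (Finset.univ : Finset (Fin R)),
          g p.1 := by
        refine mul_le_mul_of_nonneg_left ?_ (by positivity)
        refine Finset.sum_le_sum_of_subset_of_nonneg (fun p hp => ?_) (fun p _ _ => hg0 _)
        exact Finset.mem_product.2 ⟨Finset.mem_image_of_mem _ hp, Finset.mem_univ _⟩
    _ = 2 ^ σ * (R * ∑ w ∈ (s.map e.toEmbedding).image Prod.fst, g w) := by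
        rw [Finset.sum_product]; simp [Finset.mul_sum]
    _ ≤ 2 ^ σ * (R * (∑' z, g z + 1)) := by
        have := hgs.sum_le_tsum ((s.map e.toEmbedding).image Prod.fst) (fun i _ => hg0 i)
        gcongr; linarith
    _ = _ := by ring

lemma sum_n_dim (n : ℕ) (hn : 1 ≤ n) (N₀ : ℝ) (hN₀ : (n : ℝ) < N₀) :
    ∃ D : ℝ, 0 < D ∧ ∀ (R : ℕ), 0 < R → ∀ s : Finset (Fin n → ℤ),
    ∑ k ∈ s, (1 + (R : ℝ)⁻¹ * ‖intVec n k‖) ^ (-N₀) ≤ D * R ^ n := by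
  have hn0 : (0 : ℝ) < n := by exact_mod_cast hn
  have hσ : 1 < N₀ / n := (one_lt_div hn0).2 hN₀
  obtain ⟨D, hD, h⟩ := sum_one_dim (N₀ / n) hσ
  refine ⟨D ^ n, by positivity, fun R hR s => ?_⟩
  have hpt : ∀ k : Fin n → ℤ, (1 + (R : ℝ)⁻¹ * ‖intVec n k‖) ^ (-N₀) ≤
      ∏ i, (1 + (R : ℝ)⁻¹ * |(k i : ℝ)|) ^ (-(N₀ / n)) := by
    intro k
    have e : (1 + (R : ℝ)⁻¹ * ‖intVec n k‖) ^ (-N₀) =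
        ∏ i : Fin n, (1 + (R : ℝ)⁻¹ * ‖intVec n k‖) ^ (-(N₀ / n)) := by
      rw [Finset.prod_const, Finset.card_univ, Fintype.card_fin, ← Real.rpow_mul_natCast (by positivity)]
      congr 1; field_simp
    rw [e]
    refine Finset.prod_le_prod (fun i _ => by positivity) fun i _ => ?_
    refine Real.rpow_le_rpow_of_nonpos (by positivity) ?_ (by linarith)
    have : |(k i : ℝ)| ≤ ‖intVec n k‖ := by
      simpa [intVec] using PiLp.norm_apply_le (intVec n k) i
    gcongr
  calc _ ≤ ∑ k ∈ s, ∏ i, (1 + (R : ℝ)⁻¹ * |(k i : ℝ)|) ^ (-(N₀ / n)) :=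
        Finset.sum_le_sum fun k _ => hpt k
    _ ≤ ∑ k ∈ Fintype.piFinset (fun i : Fin n => s.image fun k : Fin n → ℤ => k i),
          ∏ i, (1 + (R : ℝ)⁻¹ * |(k i : ℝ)|) ^ (-(N₀ / n)) := by
        refine Finset.sum_le_sum_of_subset_of_nonneg (fun k hk => ?_)
          (fun k _ _ => Finset.prod_nonneg fun i _ => by positivity)
        exact Fintype.mem_piFinset.2 fun i => Finset.mem_image_of_mem (fun k => k i) hk
    _ = ∏ i, ∑ z ∈ s.image (fun k : Fin n → ℤ => k i), (1 + (R : ℝ)⁻¹ * |(z : ℝ)|) ^ (-(N₀ / n)) :=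
        (Finset.prod_univ_sum (fun i : Fin n => s.image fun k : Fin n → ℤ => k i)
          (fun _ z => (1 + (R : ℝ)⁻¹ * |(z : ℝ)|) ^ (-(N₀ / n)))).symm
    _ ≤ ∏ i : Fin n, (D * R) :=
        Finset.prod_le_prod (fun i _ => Finset.sum_nonneg fun z _ => by positivity)
          fun i _ => h R hR _
    _ = _ := by simp [mul_pow]

lemma sum_pair (n : ℕ) (N₀ D : ℝ) (hD : 0 < D)
    (h : ∀ (R : ℕ), 0 < R → ∀ s : Finset (Fin n → ℤ),
      ∑ k ∈ s, (1 + (R : ℝ)⁻¹ * ‖intVec n k‖) ^ (-N₀) ≤ D * R ^ n)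
    (R₁ R₂ : ℕ) (h₁ : 0 < R₁) (h₂ : 0 < R₂) (k l : Fin n → ℤ)
    (s : Finset ((Fin n → ℤ) × (Fin n → ℤ))) :
    ∑ q ∈ s, (1 + (R₁ : ℝ)⁻¹ * ‖intVec n (k - q.1)‖) ^ (-N₀) *
      (1 + (R₂ : ℝ)⁻¹ * ‖intVec n (l - q.2)‖) ^ (-N₀) ≤ D ^ 2 * (R₁ ^ n * R₂ ^ n) := by
  have hs : ∀ (R : ℕ), 0 < R → ∀ (k : Fin n → ℤ) (s : Finset (Fin n → ℤ)),
      ∑ x ∈ s, (1 + (R : ℝ)⁻¹ * ‖intVec n (k - x)‖) ^ (-N₀) ≤ D * R ^ n := by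
    intro R hR k s
    have := h R hR (s.map (Equiv.subLeft k).toEmbedding)
    rw [Finset.sum_map] at this
    simpa using this
  calc _ ≤ ∑ q ∈ (s.image Prod.fst) ×ˢ (s.image Prod.snd),
        (1 + (R₁ : ℝ)⁻¹ * ‖intVec n (k - q.1)‖) ^ (-N₀) *
          (1 + (R₂ : ℝ)⁻¹ * ‖intVec n (l - q.2)‖) ^ (-N₀) :=
        Finset.sum_le_sum_of_subset_of_nonneg Finset.subset_product
          (fun k _ _ => by positivity)
    _ = (∑ x ∈ s.image Prod.fst, (1 + (R₁ : ℝ)⁻¹ * ‖intVec n (k - x)‖) ^ (-N₀)) *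
        ∑ y ∈ s.image Prod.snd, (1 + (R₂ : ℝ)⁻¹ * ‖intVec n (l - y)‖) ^ (-N₀) := by
        rw [Finset.sum_mul_sum, Finset.sum_product]
    _ ≤ (D * R₁ ^ n) * (D * R₂ ^ n) :=
        mul_le_mul (hs R₁ h₁ k _) (hs R₂ h₂ l _)
          (Finset.sum_nonneg fun z _ => by positivity) (by positivity)
    _ = _ := by ring

/-- Cotlar–Stein type almost-orthogonality lemma (Lemma 4 of the paper):
if the operators `T_{j,m}`, `m = (k,l) ∈ ℤⁿ × ℤⁿ`, are uniformly bounded on `L²(ℝⁿ)` and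
satisfy the stated `T T*` and `T* T` almost-orthogonality estimates with exponent `N₀ > n`,
then `∑_m T_{j,m} f` converges in `L²` for every `f` and the sum operator `T_j` satisfies
`‖T_j‖ ≤ C′ 4^{jn}` with `C′` depending only on `C`, `N₀` and `n`. -/
theorem stmt_1 (n : ℕ) (hn : 1 ≤ n) (C N₀ : ℝ) (hC : 0 < C) (hN₀ : (n : ℝ) < N₀) :
    ∃ C' : ℝ, 0 < C' ∧ ∀ (j : ℕ)
      (T : (Fin n → ℤ) × (Fin n → ℤ) → L2 n →L[ℂ] L2 n),
      (∀ q, ‖T q‖ ≤ C) →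
      (∀ k₁ l₁ k₂ l₂ : Fin n → ℤ,
        ‖(T (k₁, l₁)).comp (adjoint (T (k₂, l₂)))‖ ≤
          C * (1 + ((4 : ℝ) ^ j)⁻¹ * ‖intVec n (k₁ - k₂)‖) ^ (-(2 * N₀)) *
            (1 + ‖intVec n (l₁ - l₂)‖) ^ (-(2 * N₀))) →
      (∀ k₁ l₁ k₂ l₂ : Fin n → ℤ,
        ‖(adjoint (T (k₁, l₁))).comp (T (k₂, l₂))‖ ≤
          C * (1 + ‖intVec n (k₁ - k₂)‖) ^ (-(2 * N₀)) *
            (1 + ((4 : ℝ) ^ j)⁻¹ * ‖intVec n (l₁ - l₂)‖) ^ (-(2 * N₀))) →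
      ∃ Tj : L2 n →L[ℂ] L2 n,
        (∀ f : L2 n, HasSum (fun q => T q f) (Tj f)) ∧
        ‖Tj‖ ≤ C' * (4 : ℝ) ^ (j * n) := by
  obtain ⟨D, hD, h⟩ := sum_n_dim n hn N₀ hN₀
  refine ⟨√C * D ^ 2, by positivity, fun j T hT hTT hTT' => ?_⟩
  have hcast : ((4 ^ j : ℕ) : ℝ) = (4 : ℝ) ^ j := by push_cast; rfl
  have hsq : ∀ x : ℝ, 0 ≤ x → x ^ (-(2 * N₀)) = (x ^ (-N₀)) ^ 2 := by
    intro x hx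
    rw [← Real.rpow_mul_natCast hx]; congr 1; push_cast; ring
  have hR : 0 < 4 ^ j := by positivity
  have hCs : √C ^ 2 = C := Real.sq_sqrt hC.le
  rw [pow_mul]
  refine cs_main T
    (fun p q => √C * ((1 + ((4 : ℝ) ^ j)⁻¹ * ‖intVec n (p.1 - q.1)‖) ^ (-N₀) *
      (1 + ‖intVec n (p.2 - q.2)‖) ^ (-N₀)))
    (fun p q => √C * ((1 + ‖intVec n (p.1 - q.1)‖) ^ (-N₀) *
      (1 + ((4 : ℝ) ^ j)⁻¹ * ‖intVec n (p.2 - q.2)‖) ^ (-N₀)))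
    (√C * D ^ 2 * ((4 : ℝ) ^ j) ^ n) (√C) (by positivity) (by positivity)
    (fun p q => by positivity) (fun p q => by positivity) (fun q => by rw [hCs]; exact hT q)
    ?_ ?_ ?_ ?_
  · rintro ⟨k₁, l₁⟩ ⟨k₂, l₂⟩
    refine (hTT k₁ l₁ k₂ l₂).trans (le_of_eq ?_)
    rw [hsq _ (by positivity), hsq _ (by positivity), mul_pow, mul_pow, hCs, mul_assoc]
  · rintro ⟨k₁, l₁⟩ ⟨k₂, l₂⟩
    refine (hTT' k₁ l₁ k₂ l₂).trans (le_of_eq ?_)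
    rw [hsq _ (by positivity), hsq _ (by positivity), mul_pow, mul_pow, hCs, mul_assoc]
  · intro p s
    have := sum_pair n N₀ D hD h (4 ^ j) 1 hR one_pos p.1 p.2 s
    rw [hcast] at this
    simp only [Nat.cast_one, inv_one, one_mul, one_pow, mul_one] at this
    rw [← Finset.mul_sum, mul_assoc]
    exact mul_le_mul_of_nonneg_left this (Real.sqrt_nonneg _)
  · intro p s
    have := sum_pair n N₀ D hD h 1 (4 ^ j) one_pos hR p.1 p.2 s
    rw [hcast] at this
    simp only [Nat.cast_one, inv_one, one_mul, one_pow] at this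
    rw [← Finset.mul_sum, mul_assoc]
    exact mul_le_mul_of_nonneg_left this (Real.sqrt_nonneg _)
end
end

section
/- Let Φ¹, Φ² be real-valued Schwartz functions on ℝⁿ, let j ≥ 0 be an integer, and for (k,l) ∈ ℤⁿ × ℤⁿ define the operator T_{j,k,l} on L²(ℝⁿ) by T_{j,k,l}f(x) = ∫_{ℝⁿ} e^{i x·y} Φ¹_{j,k}(x) Φ²_{j,l}(y) f(y) dy. Then for every N₀ > n there exists a constant C, depending only on Φ¹, Φ², n and N₀, such that for all j ≥ 0 and all k, k′, l, l′ ∈ ℤⁿ: ‖T_{j,k,l} T*_{j,k′,l′}‖_{L²→L²} ≤ C (1+4^{−j}|k−k′|)^{−2N₀} (1+|l−l′|)^{−2N₀}. -/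
open MeasureTheory ContinuousLinearMap Complex
open scoped RealInnerProductSpace

noncomputable section

/-- The dilated translate `f_{j,k}(x) = 2^{nj/2} f(2^j x − k)`. -/
def dil (n : ℕ) (Φ : SchwartzMap (En n) ℝ) (j : ℕ) (k : Fin n → ℤ) (x : En n) : ℝ :=
  (2 : ℝ) ^ ((n * j : ℝ) / 2) * Φ ((2 : ℝ) ^ j • x - intVec n k)

lemma decay {n : ℕ} {F : Type*} [NormedAddCommGroup F] [NormedSpace ℝ F]
    (Ψ : SchwartzMap (En n) F) (k P : ℕ) :
    ∃ C : ℝ, 0 < C ∧ ∀ p ≤ P, ∀ x, (1 + ‖x‖) ^ k * ‖iteratedFDeriv ℝ p Ψ x‖ ≤ C := by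
  refine ⟨2 ^ k * ((Finset.Iic (k, P)).sup (fun m => SchwartzMap.seminorm ℝ m.1 m.2)) Ψ + 1, ?_, ?_⟩
  · positivity
  · intro p hp x
    have := SchwartzMap.one_add_le_sup_seminorm_apply (𝕜 := ℝ) (m := (k, P)) (k := k) (n := p)
      le_rfl hp Ψ x
    simp only at this
    linarith

lemma one_add_le {E : Type*} [NormedAddCommGroup E] (v m : E) :
    1 + ‖m‖ ≤ (1 + ‖v‖) * (1 + ‖v + m‖) := by
  have h : ‖m‖ ≤ ‖v + m‖ + ‖v‖ := by
    have := norm_sub_le (v + m) v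
    simpa using this
  nlinarith [norm_nonneg v, norm_nonneg (v + m), mul_nonneg (norm_nonneg v) (norm_nonneg (v + m))]

lemma prod_decay {n : ℕ} (Ψ : SchwartzMap (En n) ℂ) (P : ℕ) :
    ∃ C : ℝ, 0 < C ∧ ∀ p ≤ P, ∀ m v : En n, (1 + ‖m‖) ^ P * (1 + ‖v‖) ^ (n + 1) *
      ‖iteratedFDeriv ℝ p (fun y => Ψ y * Ψ (y + m)) v‖ ≤ C := by
  obtain ⟨C, hC, h⟩ := decay Ψ (P + (n + 1)) P
  refine ⟨2 ^ P * (C * C), by positivity, ?_⟩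
  intro p hp m v
  have h1 := norm_iteratedFDeriv_mul_le (𝕜 := ℝ) (N := ((⊤ : ℕ∞) : WithTop ℕ∞)) (Ψ.smooth ⊤)
    (g := fun y => Ψ (y + m)) ((Ψ.smooth ⊤).comp (by fun_prop : ContDiff ℝ _ fun y : En n => y + m)) v (n := p)
    (by exact_mod_cast le_top)
  have h2 : ∀ i ∈ Finset.range (p + 1), (1 + ‖m‖) ^ P * (1 + ‖v‖) ^ (n + 1) *
      ((p.choose i : ℝ) * ‖iteratedFDeriv ℝ i Ψ v‖ *
        ‖iteratedFDeriv ℝ (p - i) (fun y => Ψ (y + m)) v‖) ≤ (p.choose i : ℝ) * (C * C) := by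
    intro i hi
    have hi : i ≤ p := by simpa [Nat.lt_succ_iff] using hi
    rw [iteratedFDeriv_comp_add_right]
    have e1 := h i (hi.trans hp) v
    have e2 := h (p - i) ((Nat.sub_le _ _).trans hp) (v + m)
    have e3 : (1 + ‖m‖) ^ P ≤ (1 + ‖v‖) ^ P * (1 + ‖v + m‖) ^ (P + (n + 1)) := by
      calc (1 + ‖m‖) ^ P ≤ ((1 + ‖v‖) * (1 + ‖v + m‖)) ^ P := by
            gcongr; exact one_add_le v m
        _ = (1 + ‖v‖) ^ P * (1 + ‖v + m‖) ^ P := mul_pow _ _ _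
        _ ≤ _ := by
            gcongr
            · linarith [norm_nonneg (v + m)]
            · omega
    calc _ ≤ ((1 + ‖v‖) ^ P * (1 + ‖v + m‖) ^ (P + (n + 1))) * (1 + ‖v‖) ^ (n + 1) *
        ((p.choose i : ℝ) * ‖iteratedFDeriv ℝ i Ψ v‖ * ‖iteratedFDeriv ℝ (p - i) Ψ (v + m)‖) := by
          gcongr
      _ = (p.choose i : ℝ) * (((1 + ‖v‖) ^ (P + (n + 1)) * ‖iteratedFDeriv ℝ i Ψ v‖) *
          ((1 + ‖v + m‖) ^ (P + (n + 1)) * ‖iteratedFDeriv ℝ (p - i) Ψ (v + m)‖)) := by ring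
      _ ≤ _ := by gcongr
  calc _ ≤ (1 + ‖m‖) ^ P * (1 + ‖v‖) ^ (n + 1) * _ := mul_le_mul_of_nonneg_left h1 (by positivity)
    _ ≤ ∑ i ∈ Finset.range (p + 1), (p.choose i : ℝ) * (C * C) := by
      rw [Finset.mul_sum]; exact Finset.sum_le_sum h2
    _ = 2 ^ p * (C * C) := by
      rw [← Finset.sum_mul]; congr 1; exact_mod_cast Nat.sum_range_choose p
    _ ≤ _ := by gcongr; norm_num

lemma jap_integrable (n : ℕ) : Integrable (fun v : En n => ((1 + ‖v‖) ^ (n + 1))⁻¹) := by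
  have := integrable_one_add_norm (E := En n) (μ := volume) (r := (n : ℝ) + 1) (by simp)
  refine this.congr (Filter.Eventually.of_forall fun v => ?_)
  simp only
  rw [Real.rpow_neg (by positivity)]
  exact_mod_cast rfl

open scoped FourierTransform in
lemma fourier_decay {n : ℕ} (Ψ : SchwartzMap (En n) ℂ) (P : ℕ) :
    ∃ C : ℝ, 0 < C ∧ ∀ m w : En n, (1 + ‖m‖) ^ P * (1 + ‖w‖) ^ P *
      ‖𝓕 (fun y => Ψ y * Ψ (y + m)) w‖ ≤ C := by
  obtain ⟨C, hC, h⟩ := prod_decay Ψ P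
  set J := ∫ v : En n, ((1 + ‖v‖) ^ (n + 1))⁻¹ with hJ
  have hJ0 : 0 ≤ J := integral_nonneg fun v => by positivity
  refine ⟨2 ^ P * (2 * (2 ^ P * ((P + 1) * (C * J)))) + 1, by positivity, ?_⟩
  intro m w
  set g : En n → ℂ := fun y => Ψ y * Ψ (y + m) with hg
  have hgs : ContDiff ℝ ((⊤ : ℕ∞) : WithTop ℕ∞) g :=
    (Ψ.smooth ⊤).mul ((Ψ.smooth ⊤).comp (by fun_prop : ContDiff ℝ _ fun y : En n => y + m))
  have hb : ∀ p ≤ P, ∀ v, ‖iteratedFDeriv ℝ p g v‖ ≤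
      C * ((1 + ‖m‖) ^ P)⁻¹ * ((1 + ‖v‖) ^ (n + 1))⁻¹ := by
    intro p hp v
    have := h p hp m v
    rw [← div_eq_mul_inv, ← div_eq_mul_inv, le_div_iff₀ (by positivity), le_div_iff₀ (by positivity)]
    calc _ = _ := by ring
      _ ≤ C := this
  have hdom := (jap_integrable n).const_mul (C * ((1 + ‖m‖) ^ P)⁻¹)
  have hint : ∀ p ≤ P, Integrable (fun v => ‖iteratedFDeriv ℝ p g v‖) := by
    intro p hp
    refine hdom.mono' ?_ (Filter.Eventually.of_forall fun v => ?_)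
    · exact ((hgs.continuous_iteratedFDeriv (by exact_mod_cast le_top)).norm).aestronglyMeasurable
    · simpa using hb p hp v
  have hI : ∀ p ≤ P, ∫ v, ‖iteratedFDeriv ℝ p g v‖ ≤ C * ((1 + ‖m‖) ^ P)⁻¹ * J := by
    intro p hp
    rw [hJ, ← integral_const_mul]
    exact integral_mono (hint p hp) hdom (hb p hp)
  have key : ∀ q ≤ P, ‖w‖ ^ q * ‖𝓕 g w‖ ≤ 2 ^ P * ((P + 1) * (C * ((1 + ‖m‖) ^ P)⁻¹ * J)) := by
    intro q hq
    have := Real.pow_mul_norm_iteratedFDeriv_fourier_le (f := g) (K := 0) (N := (P : ℕ∞))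
      (hgs.of_le (by exact_mod_cast le_top)) (by
        intro k p hk hp
        have hk : k = 0 := by simpa using hk
        subst hk
        simpa using hint p (by exact_mod_cast hp)) (k := 0) (n := q) (by simp) (by exact_mod_cast hq) w
    rw [norm_iteratedFDeriv_zero] at this
    refine this.trans ?_
    simp only [Nat.cast_zero, mul_zero, zero_add, pow_zero, one_mul, Finset.range_one,
      Finset.singleton_product, Finset.sum_map, Function.Embedding.coeFn_mk]
    refine mul_le_mul (pow_le_pow_right₀ (by norm_num) hq) ?_
      (Finset.sum_nonneg fun i _ => integral_nonneg fun v => by positivity) (by positivity)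
    calc _ ≤ ∑ p ∈ Finset.range (q + 1), (C * ((1 + ‖m‖) ^ P)⁻¹ * J) := by
            apply Finset.sum_le_sum
            intro p hp
            have : p ≤ P := by
              have := Finset.mem_range.1 hp
              omega
            simpa using hI p this
      _ = (q + 1) * (C * ((1 + ‖m‖) ^ P)⁻¹ * J) := by simp
      _ ≤ _ := by gcongr
  have k0 := key 0 (Nat.zero_le _)
  have kP := key P le_rfl
  have e : (1 + ‖w‖) ^ P ≤ 2 ^ P * (1 + ‖w‖ ^ P) := by
    have := add_pow_le (zero_le_one' ℝ) (norm_nonneg w) P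
    refine this.trans ?_
    rw [one_pow]
    gcongr
    · norm_num
    · omega
  have : (1 + ‖w‖) ^ P * ‖𝓕 g w‖ ≤
      2 ^ P * (2 * (2 ^ P * ((P + 1) * (C * ((1 + ‖m‖) ^ P)⁻¹ * J)))) := by
    calc _ ≤ 2 ^ P * (1 + ‖w‖ ^ P) * ‖𝓕 g w‖ := by gcongr
      _ = 2 ^ P * (‖w‖ ^ 0 * ‖𝓕 g w‖ + ‖w‖ ^ P * ‖𝓕 g w‖) := by ring
      _ ≤ _ := by gcongr; linarith
  calc _ = (1 + ‖m‖) ^ P * ((1 + ‖w‖) ^ P * ‖𝓕 g w‖) := by ring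
    _ ≤ (1 + ‖m‖) ^ P * _ := mul_le_mul_of_nonneg_left this (by positivity)
    _ = 2 ^ P * (2 * (2 ^ P * ((P + 1) * (C * J)))) := by
      have : (1 + ‖m‖) ^ P ≠ 0 := by positivity
      field_simp
    _ ≤ _ := by linarith

lemma osc_decay {n : ℕ} (Φ : SchwartzMap (En n) ℝ) (P : ℕ) :
    ∃ C : ℝ, 0 < C ∧ ∀ m w : En n, (1 + ‖m‖) ^ P * (1 + ‖w‖) ^ P *
      ‖∫ y : En n, Complex.exp (Complex.I * ((⟪w, y⟫ : ℝ) : ℂ)) *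
        ((Φ y : ℂ) * (Φ (y + m) : ℂ))‖ ≤ C := by
  obtain ⟨C, hC, h⟩ := fourier_decay (SchwartzMap.postcompCLM Complex.ofRealCLM Φ) P
  refine ⟨(2 * Real.pi) ^ P * C, by positivity, ?_⟩
  intro m w
  have h1 := h m (-(2 * Real.pi)⁻¹ • w)
  rw [Real.fourier_eq'] at h1
  have e : (∫ v : En n, Complex.exp ((↑(-2 * Real.pi * ⟪v, -(2 * Real.pi)⁻¹ • w⟫) * Complex.I)) •
      ((SchwartzMap.postcompCLM Complex.ofRealCLM Φ) v *
        (SchwartzMap.postcompCLM Complex.ofRealCLM Φ) (v + m))) =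
      ∫ y : En n, Complex.exp (Complex.I * ((⟪w, y⟫ : ℝ) : ℂ)) *
        ((Φ y : ℂ) * (Φ (y + m) : ℂ)) := by
    congr 1
    ext v
    rw [inner_smul_right, real_inner_comm]
    have : -2 * Real.pi * (-(2 * Real.pi)⁻¹ * ⟪w, v⟫) = ⟪w, v⟫ := by
      have := Real.pi_ne_zero
      field_simp
    rw [this, mul_comm Complex.I]
    simp [SchwartzMap.postcompCLM_apply]
  rw [e] at h1
  have hw : 1 + ‖w‖ ≤ (2 * Real.pi) * (1 + ‖-(2 * Real.pi)⁻¹ • w‖) := by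
    rw [norm_smul, norm_neg, Real.norm_of_nonneg (by positivity), mul_add, ← mul_assoc,
      mul_inv_cancel₀ (by positivity)]
    linarith [Real.pi_gt_three]
  have hw2 := pow_le_pow_left₀ (by positivity) hw P
  rw [mul_pow] at hw2
  refine le_trans ?_ (mul_le_mul_of_nonneg_left h1 (by positivity : 0 ≤ (2 * Real.pi) ^ P))
  calc _ ≤ (1 + ‖m‖) ^ P * ((2 * Real.pi) ^ P * (1 + ‖-(2 * Real.pi)⁻¹ • w‖) ^ P) * _ :=
        mul_le_mul_of_nonneg_right (mul_le_mul_of_nonneg_left hw2 (by positivity)) (norm_nonneg _)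
    _ = _ := by ring

lemma intVec_sub (n : ℕ) (k k' : Fin n → ℤ) : intVec n (k - k') = intVec n k - intVec n k' := by
  ext i
  simp [intVec]

lemma integral_scale {n : ℕ} {F : Type*} [NormedAddCommGroup F] [NormedSpace ℝ F] (f : En n → F)
    (j : ℕ) (a : En n) :
    ∫ y : En n, f ((2 : ℝ) ^ j • y - a) = ((2 : ℝ) ^ (n * j))⁻¹ • ∫ y, f y := by
  rw [Measure.integral_comp_smul volume (fun y => f (y - a)) ((2 : ℝ) ^ j), integral_sub_right_eq_self]
  congr 1
  rw [abs_of_pos (by positivity), finrank_euclideanSpace, Fintype.card_fin, ← pow_mul, mul_comm]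

lemma two_half (n j : ℕ) : (2 : ℝ) ^ ((n * j : ℝ) / 2) * (2 : ℝ) ^ ((n * j : ℝ) / 2) = 2 ^ (n * j) := by
  rw [← Real.rpow_add (by norm_num), add_halves, ← Nat.cast_mul, Real.rpow_natCast]

lemma osc_dil {n : ℕ} (Φ : SchwartzMap (En n) ℝ) (P : ℕ) :
    ∃ C : ℝ, 0 < C ∧ ∀ (j : ℕ) (l l' : Fin n → ℤ) (w : En n),
      (1 + ‖intVec n (l - l')‖) ^ P * (1 + ((2 : ℝ) ^ j)⁻¹ * ‖w‖) ^ P *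
      ‖∫ y : En n, Complex.exp (Complex.I * ((⟪w, y⟫ : ℝ) : ℂ)) *
        ((dil n Φ j l y : ℂ) * (dil n Φ j l' y : ℂ))‖ ≤ C := by
  obtain ⟨C, hC, h⟩ := osc_decay Φ P
  refine ⟨C, hC, fun j l l' w => ?_⟩
  have h1 := h (intVec n (l - l')) (((2 : ℝ) ^ j)⁻¹ • w)
  set w' := ((2 : ℝ) ^ j)⁻¹ • w with hw'
  have hn : ‖w'‖ = ((2 : ℝ) ^ j)⁻¹ * ‖w‖ := by
    rw [hw', norm_smul, Real.norm_of_nonneg (by positivity)]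
  rw [hn] at h1
  refine le_trans (le_of_eq ?_) h1
  congr 1
  have e := integral_scale (fun u : En n => Complex.exp (Complex.I * ((⟪w', u + intVec n l⟫ : ℝ) : ℂ)) *
    (((2 : ℝ) ^ (n * j) : ℝ) : ℂ) * ((Φ u : ℂ) * (Φ (u + intVec n (l - l')) : ℂ))) j (intVec n l)
  have e1 : ∀ y : En n, Complex.exp (Complex.I * ((⟪w, y⟫ : ℝ) : ℂ)) *
        ((dil n Φ j l y : ℂ) * (dil n Φ j l' y : ℂ)) =
      (fun u : En n => Complex.exp (Complex.I * ((⟪w', u + intVec n l⟫ : ℝ) : ℂ)) *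
    (((2 : ℝ) ^ (n * j) : ℝ) : ℂ) * ((Φ u : ℂ) * (Φ (u + intVec n (l - l')) : ℂ)))
      ((2 : ℝ) ^ j • y - intVec n l) := by
    intro y
    simp only [dil]
    have a1 : (⟪w', (2 : ℝ) ^ j • y - intVec n l + intVec n l⟫ : ℝ) = ⟪w, y⟫ := by
      rw [sub_add_cancel, hw', inner_smul_left, inner_smul_right]
      simp
    have a2 : (2 : ℝ) ^ j • y - intVec n l + intVec n (l - l') = (2 : ℝ) ^ j • y - intVec n l' := by
      rw [intVec_sub]; abel
    rw [a1, a2, ← two_half]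
    push_cast
    ring
  simp_rw [e1]
  rw [e]
  have e2 : ∀ u : En n, Complex.exp (Complex.I * ((⟪w', u + intVec n l⟫ : ℝ) : ℂ)) *
    (((2 : ℝ) ^ (n * j) : ℝ) : ℂ) * ((Φ u : ℂ) * (Φ (u + intVec n (l - l')) : ℂ)) =
    (Complex.exp (((⟪w', intVec n l⟫ : ℝ) : ℂ) * Complex.I) * (((2 : ℝ) ^ (n * j) : ℝ) : ℂ)) *
    (Complex.exp (Complex.I * ((⟪w', u⟫ : ℝ) : ℂ)) * ((Φ u : ℂ) * (Φ (u + intVec n (l - l')) : ℂ))) := by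
    intro u
    rw [inner_add_right, Complex.ofReal_add, mul_add, Complex.exp_add, mul_comm Complex.I (((⟪w', intVec n l⟫ : ℝ) : ℂ))]
    ring
  simp_rw [e2]
  rw [integral_const_mul, norm_smul, norm_mul, norm_mul, Complex.norm_exp_ofReal_mul_I,
    Complex.norm_real, one_mul, norm_inv, ← mul_assoc,
    inv_mul_cancel₀ (norm_ne_zero_iff.2 (by positivity)), one_mul]

/-- The weight function. -/
def wt (n j : ℕ) (k : Fin n → ℤ) (x : En n) : ℝ :=
  (2 : ℝ) ^ ((n * j : ℝ) / 2) * ((1 + ‖(2 : ℝ) ^ j • x - intVec n k‖) ^ (n + 1))⁻¹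

lemma wt_pos (n j : ℕ) (k : Fin n → ℤ) (x : En n) : 0 < wt n j k x := by
  unfold wt; positivity

lemma sq_jap_integrable (n : ℕ) : Integrable (fun v : En n => (((1 + ‖v‖) ^ (n + 1))⁻¹) ^ 2) := by
  refine (jap_integrable n).mono' (by fun_prop) (Filter.Eventually.of_forall fun v => ?_)
  rw [Real.norm_of_nonneg (by positivity)]
  have h1 : ((1 + ‖v‖) ^ (n + 1))⁻¹ ≤ 1 :=
    inv_le_one_of_one_le₀ (one_le_pow₀ (by linarith [norm_nonneg v]))
  have h0 : 0 ≤ ((1 + ‖v‖) ^ (n + 1))⁻¹ := by positivity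
  nlinarith

lemma wt_cont (n j : ℕ) (k : Fin n → ℤ) : Continuous (wt n j k) := by
  unfold wt
  refine continuous_const.mul (Continuous.inv₀ (by fun_prop) fun x => by positivity)

lemma wt_sq (n j : ℕ) (k : Fin n → ℤ) (x : En n) : wt n j k x ^ 2 =
    (2 : ℝ) ^ (n * j) * (fun v : En n => (((1 + ‖v‖) ^ (n + 1))⁻¹) ^ 2) ((2 : ℝ) ^ j • x - intVec n k) := by
  rw [← two_half]
  simp only [wt]
  ring

lemma wt_memLp (n j : ℕ) (k : Fin n → ℤ) : MemLp (wt n j k) 2 (volume : Measure (En n)) := by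
  rw [memLp_two_iff_integrable_sq (wt_cont n j k).aestronglyMeasurable]
  simp_rw [wt_sq]
  refine Integrable.const_mul ?_ _
  have h1 := (sq_jap_integrable n).comp_sub_right (intVec n k)
  exact h1.comp_smul (R := (2 : ℝ) ^ j) (by positivity)

lemma wt_norm (n j : ℕ) (k : Fin n → ℤ) : ‖(wt_memLp n j k).toLp‖ ^ 2 =
    ∫ v : En n, (((1 + ‖v‖) ^ (n + 1))⁻¹) ^ 2 := by
  rw [← real_inner_self_eq_norm_sq, L2.inner_def]
  have : ∫ x, ⟪(wt_memLp n j k).toLp (wt n j k) x, (wt_memLp n j k).toLp (wt n j k) x⟫ = ∫ x, wt n j k x ^ 2 := by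
    refine integral_congr_ae ?_
    filter_upwards [(wt_memLp n j k).coeFn_toLp] with x hx
    rw [hx, real_inner_self_eq_norm_sq, Real.norm_eq_abs, sq_abs]
  rw [this]
  simp_rw [wt_sq]
  rw [integral_const_mul,
    integral_scale (fun v : En n => (((1 + ‖v‖) ^ (n + 1))⁻¹) ^ 2) j (intVec n k),
    smul_eq_mul, ← mul_assoc, mul_inv_cancel₀ (by positivity),
    one_mul]

lemma dil_bound {n : ℕ} (Φ : SchwartzMap (En n) ℝ) (P : ℕ) :
    ∃ C : ℝ, 0 < C ∧ ∀ (j : ℕ) (k : Fin n → ℤ) (x : En n),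
      |dil n Φ j k x| * (1 + ‖(2 : ℝ) ^ j • x - intVec n k‖) ^ P ≤ C * wt n j k x := by
  obtain ⟨C, hC, h⟩ := decay Φ (P + (n + 1)) 0
  refine ⟨C, hC, fun j k x => ?_⟩
  have h1 := h 0 le_rfl ((2 : ℝ) ^ j • x - intVec n k)
  rw [norm_iteratedFDeriv_zero, Real.norm_eq_abs, pow_add] at h1
  unfold dil wt
  rw [abs_mul, abs_of_pos (by positivity : (0 : ℝ) < (2 : ℝ) ^ ((n * j : ℝ) / 2))]
  set t := 1 + ‖(2 : ℝ) ^ j • x - intVec n k‖ with ht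
  have htp : 0 < t := by positivity
  set r := (2 : ℝ) ^ ((n * j : ℝ) / 2) with hr
  have hrp : 0 < r := by positivity
  rw [mul_left_comm, ← div_eq_mul_inv, mul_assoc]
  refine mul_le_mul_of_nonneg_left ?_ hrp.le
  rw [le_div_iff₀ (by positivity)]
  calc _ = _ := by ring
    _ ≤ C := h1

lemma geom {n : ℕ} (j : ℕ) (k k' : Fin n → ℤ) (x z : En n) :
    1 + ((4 : ℝ) ^ j)⁻¹ * ‖intVec n (k - k')‖ ≤
      (1 + ‖(2 : ℝ) ^ j • x - intVec n k‖) * (1 + ‖(2 : ℝ) ^ j • z - intVec n k'‖) *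
        (1 + ((2 : ℝ) ^ j)⁻¹ * ‖z - x‖) := by
  have h4 : (4 : ℝ) ^ j = 2 ^ j * 2 ^ j := by rw [← mul_pow]; norm_num
  have hp : (1 : ℝ) ≤ 2 ^ j := one_le_pow₀ (by norm_num)
  have h41 : ((4 : ℝ) ^ j)⁻¹ ≤ 1 := inv_le_one_of_one_le₀ (one_le_pow₀ (by norm_num))
  have h40 : 0 < ((4 : ℝ) ^ j)⁻¹ := by positivity
  have e : intVec n (k - k') = ((2 : ℝ) ^ j • z - intVec n k') - ((2 : ℝ) ^ j • x - intVec n k)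
      - (2 : ℝ) ^ j • (z - x) := by
    rw [intVec_sub, smul_sub]; abel
  have h1 : ‖intVec n (k - k')‖ ≤ ‖(2 : ℝ) ^ j • z - intVec n k'‖ + ‖(2 : ℝ) ^ j • x - intVec n k‖
      + 2 ^ j * ‖z - x‖ := by
    rw [e]
    refine (norm_sub_le _ _).trans ?_
    refine add_le_add (norm_sub_le _ _) ?_
    rw [norm_smul, Real.norm_of_nonneg (by positivity)]
  set a := ‖(2 : ℝ) ^ j • x - intVec n k‖
  set b := ‖(2 : ℝ) ^ j • z - intVec n k'‖
  have ha : 0 ≤ a := norm_nonneg _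
  have hb : 0 ≤ b := norm_nonneg _
  set c := ((2 : ℝ) ^ j)⁻¹ * ‖z - x‖ with hc
  have hc0 : 0 ≤ c := by positivity
  have h2 : ((4 : ℝ) ^ j)⁻¹ * ‖intVec n (k - k')‖ ≤ a + b + c := by
    calc _ ≤ ((4 : ℝ) ^ j)⁻¹ * (b + a + 2 ^ j * ‖z - x‖) := by gcongr
      _ = ((4 : ℝ) ^ j)⁻¹ * (a + b) + c := by
        rw [h4, hc]; field_simp; ring
      _ ≤ 1 * (a + b) + c := by gcongr
      _ = _ := by ring
  have : 0 ≤ a * b := by positivity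
  have : 0 ≤ a * c := by positivity
  have : 0 ≤ b * c := by positivity
  have : 0 ≤ a * b * c := by positivity
  nlinarith

lemma kernel_bound {n : ℕ} (Φ1 Φ2 : SchwartzMap (En n) ℝ) (P : ℕ) :
    ∃ C : ℝ, 0 < C ∧ ∀ (j : ℕ) (k k' l l' : Fin n → ℤ) (x z : En n),
      |dil n Φ1 j k x| * |dil n Φ1 j k' z| *
      ‖∫ y : En n, Complex.exp (Complex.I * ((⟪z - x, y⟫ : ℝ) : ℂ)) *
        ((dil n Φ2 j l y : ℂ) * (dil n Φ2 j l' y : ℂ))‖ ≤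
      C * ((1 + ((4 : ℝ) ^ j)⁻¹ * ‖intVec n (k - k')‖) ^ P)⁻¹ *
        ((1 + ‖intVec n (l - l')‖) ^ P)⁻¹ * wt n j k x * wt n j k' z := by
  obtain ⟨C1, hC1, h1⟩ := dil_bound Φ1 P
  obtain ⟨C2, hC2, h2⟩ := osc_dil Φ2 P
  refine ⟨C1 * C1 * C2, by positivity, fun j k k' l l' x z => ?_⟩
  have a1 := h1 j k x
  have a2 := h1 j k' z
  have a3 := h2 j l l' (z - x)
  have g := pow_le_pow_left₀ (by positivity) (geom j k k' x z) P
  rw [mul_pow, mul_pow] at g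
  set I := ‖∫ y : En n, Complex.exp (Complex.I * ((⟪z - x, y⟫ : ℝ) : ℂ)) *
        ((dil n Φ2 j l y : ℂ) * (dil n Φ2 j l' y : ℂ))‖
  have hI : 0 ≤ I := norm_nonneg _
  set A := (1 + ((4 : ℝ) ^ j)⁻¹ * ‖intVec n (k - k')‖) ^ P
  have hA : 0 < A := by positivity
  set B := (1 + ‖intVec n (l - l')‖) ^ P
  have hB : 0 < B := by positivity
  have w1 := wt_pos n j k x
  have w2 := wt_pos n j k' z
  set U := (1 + ‖(2 : ℝ) ^ j • x - intVec n k‖) ^ P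
  set V := (1 + ‖(2 : ℝ) ^ j • z - intVec n k'‖) ^ P
  set W := (1 + ((2 : ℝ) ^ j)⁻¹ * ‖z - x‖) ^ P
  have hU : 0 ≤ U := by positivity
  have hV : 0 ≤ V := by positivity
  have hW : 0 ≤ W := by positivity
  have key : |dil n Φ1 j k x| * |dil n Φ1 j k' z| * I * (A * B) ≤
      C1 * C1 * C2 * (wt n j k x * wt n j k' z) := by
    calc _ ≤ |dil n Φ1 j k x| * |dil n Φ1 j k' z| * I * (U * V * W * B) := by gcongr
      _ = (|dil n Φ1 j k x| * U) * (|dil n Φ1 j k' z| * V) * (B * W * I) := by ring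
      _ ≤ (C1 * wt n j k x) * (C1 * wt n j k' z) * C2 := by gcongr
      _ = _ := by ring
  rw [← le_div_iff₀ (by positivity)] at key
  refine key.trans (le_of_eq ?_)
  field_simp

lemma dil_cont {n : ℕ} (Φ : SchwartzMap (En n) ℝ) (j : ℕ) (k : Fin n → ℤ) :
    Continuous (dil n Φ j k) := by
  unfold dil
  have := Φ.continuous
  fun_prop

/-- The conjugated kernel section. -/
def sec (n : ℕ) (Φ1 Φ2 : SchwartzMap (En n) ℝ) (j : ℕ) (k l : Fin n → ℤ) (x y : En n) : ℂ :=
  Complex.exp (-(Complex.I * ((⟪x, y⟫ : ℝ) : ℂ))) *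
          ((dil n Φ1 j k x : ℝ) : ℂ) * ((dil n Φ2 j l y : ℝ) : ℂ)

lemma sec_memLp (n : ℕ) (Φ1 Φ2 : SchwartzMap (En n) ℝ) (j : ℕ) (k l : Fin n → ℤ) (x : En n) :
    MemLp (sec n Φ1 Φ2 j k l x) 2 (volume : Measure (En n)) := by
  obtain ⟨C, hC, h⟩ := dil_bound Φ2 0
  have hc := dil_cont Φ2 j l
  refine MemLp.of_le_mul (c := |dil n Φ1 j k x| * C) (wt_memLp n j l) ?_
    (Filter.Eventually.of_forall fun y => ?_)
  · unfold sec
    exact Continuous.aestronglyMeasurable (by fun_prop)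
  · have h1 := h j l y
    rw [pow_zero, mul_one] at h1
    unfold sec
    have e : -(Complex.I * ((⟪x, y⟫ : ℝ) : ℂ)) = ((-⟪x, y⟫ : ℝ) : ℂ) * Complex.I := by
      push_cast; ring
    rw [e, norm_mul, norm_mul, Complex.norm_exp_ofReal_mul_I, Complex.norm_real, Complex.norm_real,
      one_mul, Real.norm_eq_abs, Real.norm_eq_abs, Real.norm_of_nonneg (wt_pos n j l y).le, mul_assoc]
    gcongr

set_option maxHeartbeats 2000000 in
theorem stmt_2 (n : ℕ) (hn : 1 ≤ n) (Φ1 Φ2 : SchwartzMap (En n) ℝ)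
    (N₀ : ℝ) (hN₀ : (n : ℝ) < N₀) :
    ∃ C : ℝ, 0 < C ∧ ∀ (j : ℕ)
      (T : (Fin n → ℤ) → (Fin n → ℤ) → L2 n →L[ℂ] L2 n),
      (∀ (k l : Fin n → ℤ) (f : L2 n), ∀ᵐ x : En n,
        T k l f x = ∫ y : En n, Complex.exp (Complex.I * ((⟪x, y⟫ : ℝ) : ℂ)) *
          ((dil n Φ1 j k x : ℝ) : ℂ) * ((dil n Φ2 j l y : ℝ) : ℂ) * f y) →
      ∀ k k' l l' : Fin n → ℤ,
        ‖(T k l).comp (adjoint (T k' l'))‖ ≤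
          C * (1 + ((4 : ℝ) ^ j)⁻¹ * ‖intVec n (k - k')‖) ^ (-(2 * N₀)) *
            (1 + ‖intVec n (l - l')‖) ^ (-(2 * N₀)) := by
  obtain ⟨P, hP⟩ := exists_nat_ge (2 * N₀)
  obtain ⟨C, hC, hK⟩ := kernel_bound Φ1 Φ2 P
  set D := ∫ v : En n, (((1 + ‖v‖) ^ (n + 1))⁻¹) ^ 2 with hD
  have hD0 : 0 ≤ D := integral_nonneg fun v => by positivity
  refine ⟨C * (D + 1), by positivity, fun j T hT k k' l l' => ?_⟩
  set A := ((1 + ((4 : ℝ) ^ j)⁻¹ * ‖intVec n (k - k')‖) ^ P)⁻¹ with hA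
  set B := ((1 + ‖intVec n (l - l')‖) ^ P)⁻¹ with hB
  have hA0 : 0 < A := by positivity
  have hB0 : 0 < B := by positivity
  have rp : ∀ X : ℝ, 0 ≤ X → ((1 + X) ^ P)⁻¹ ≤ (1 + X) ^ (-(2 * N₀)) := by
    intro X hX
    rw [← Real.rpow_natCast, ← Real.rpow_neg (by positivity)]
    exact Real.rpow_le_rpow_of_exponent_le (by linarith) (by linarith)
  suffices hs : ‖(T k l).comp (adjoint (T k' l'))‖ ≤ C * (D + 1) * A * B by
    refine hs.trans ?_
    have r1 := rp (((4 : ℝ) ^ j)⁻¹ * ‖intVec n (k - k')‖) (by positivity)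
    have r2 := rp ‖intVec n (l - l')‖ (by positivity)
    gcongr
  set w := (wt_memLp n j k).toLp (wt n j k) with hw
  set w' := (wt_memLp n j k').toLp (wt n j k') with hw'
  have nw : ‖w‖ * ‖w'‖ = D := by
    have a1 : ‖w‖ ^ 2 = D := wt_norm n j k
    have a2 : ‖w'‖ ^ 2 = D := wt_norm n j k'
    have : ‖w‖ = ‖w'‖ := by
      rw [← Real.sqrt_sq (norm_nonneg w), a1, ← a2, Real.sqrt_sq (norm_nonneg _)]
    rw [← this, ← sq, a1]
  have hsec : ∀ x : En n, ‖T k' l' ((sec_memLp n Φ1 Φ2 j k l x).toLp)‖ ≤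
      C * A * B * wt n j k x * ‖w'‖ := by
    intro x
    refine Lp.norm_le_mul_norm_of_ae_le_mul ?_
    filter_upwards [hT k' l' ((sec_memLp n Φ1 Φ2 j k l x).toLp),
      (wt_memLp n j k').coeFn_toLp] with z hz hwz
    rw [hz, hwz, Real.norm_of_nonneg (wt_pos n j k' z).le]
    refine le_trans (le_of_eq ?_) (hK j k k' l l' x z)
    have e : ∫ y : En n, Complex.exp (Complex.I * ((⟪z, y⟫ : ℝ) : ℂ)) *
          ((dil n Φ1 j k' z : ℝ) : ℂ) * ((dil n Φ2 j l' y : ℝ) : ℂ) *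
          (sec_memLp n Φ1 Φ2 j k l x).toLp (sec n Φ1 Φ2 j k l x) y =
        ∫ y : En n, (((dil n Φ1 j k x : ℝ) : ℂ) * ((dil n Φ1 j k' z : ℝ) : ℂ)) *
          (Complex.exp (Complex.I * ((⟪z - x, y⟫ : ℝ) : ℂ)) *
          ((dil n Φ2 j l y : ℂ) * (dil n Φ2 j l' y : ℂ))) := by
      refine integral_congr_ae ?_
      filter_upwards [(sec_memLp n Φ1 Φ2 j k l x).coeFn_toLp] with y hy
      rw [hy, sec, inner_sub_left, Complex.ofReal_sub, mul_sub, sub_eq_add_neg, Complex.exp_add]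
      ring
    rw [e, integral_const_mul, norm_mul, norm_mul, Complex.norm_real, Complex.norm_real,
      Real.norm_eq_abs, Real.norm_eq_abs]
  refine ContinuousLinearMap.opNorm_le_bound _ (by positivity) fun f => ?_
  have main : ‖(T k l).comp (adjoint (T k' l')) f‖ ≤ (C * A * B * ‖w'‖ * ‖f‖) * ‖w‖ := by
    refine Lp.norm_le_mul_norm_of_ae_le_mul ?_
    filter_upwards [hT k l (adjoint (T k' l') f), (wt_memLp n j k).coeFn_toLp] with x hx hwx
    rw [ContinuousLinearMap.comp_apply, hx, hwx, Real.norm_of_nonneg (wt_pos n j k x).le]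
    have e : ∫ y : En n, Complex.exp (Complex.I * ((⟪x, y⟫ : ℝ) : ℂ)) *
          ((dil n Φ1 j k x : ℝ) : ℂ) * ((dil n Φ2 j l y : ℝ) : ℂ) * (adjoint (T k' l') f) y =
        inner ℂ ((sec_memLp n Φ1 Φ2 j k l x).toLp) (adjoint (T k' l') f) := by
      rw [L2.inner_def]
      refine integral_congr_ae ?_
      filter_upwards [(sec_memLp n Φ1 Φ2 j k l x).coeFn_toLp] with y hy
      rw [hy, sec, RCLike.inner_apply', map_mul, map_mul, ← Complex.exp_conj]
      simp
    rw [e, ContinuousLinearMap.adjoint_inner_right]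
    refine (norm_inner_le_norm _ _).trans ?_
    refine (mul_le_mul_of_nonneg_right (hsec x) (norm_nonneg f)).trans (le_of_eq ?_)
    ring
  refine main.trans ?_
  calc _ = C * (‖w‖ * ‖w'‖) * A * B * ‖f‖ := by ring
    _ ≤ _ := by
      rw [nw]
      gcongr
      linarith
end
end

section
/- Let Φ¹, Φ² be real-valued Schwartz functions on ℝⁿ, let j ≥ 0 be an integer, and for (k,l) ∈ ℤⁿ × ℤⁿ define the operator T_{j,k,l} on L²(ℝⁿ) by T_{j,k,l}f(x) = ∫_{ℝⁿ} e^{i x·y} Φ¹_{j,k}(x) Φ²_{j,l}(y) f(y) dy. Then for every N₀ > n there exists a constant C, depending only on Φ¹, Φ², n and N₀, such that for all j ≥ 0 and all k, k′, l, l′ ∈ ℤⁿ: ‖T*_{j,k,l} T_{j,k′,l′}‖_{L²→L²} ≤ C (1+|k−k′|)^{−2N₀} (1+4^{−j}|l−l′|)^{−2N₀}. -/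
open MeasureTheory ContinuousLinearMap Complex
open scoped RealInnerProductSpace

noncomputable section

lemma aux_decay {n : ℕ} (Φ : SchwartzMap (En n) ℝ) (K P : ℕ) :
    ∃ C : ℝ, 0 < C ∧ ∀ i ≤ P, ∀ x, (1 + ‖x‖) ^ K * ‖iteratedFDeriv ℝ i Φ x‖ ≤ C := by
  refine ⟨2 ^ K * ((Finset.Iic (K, P)).sup (fun m => SchwartzMap.seminorm ℝ m.1 m.2)) Φ + 1,
    by positivity, fun i hi x => ?_⟩
  have := SchwartzMap.one_add_le_sup_seminorm_apply (𝕜 := ℝ) (m := (K, P)) (k := K) (n := i)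
    le_rfl hi Φ x
  simp only at this
  linarith

lemma aux_tri {n : ℕ} (a b u : En n) : 1 + ‖a - b‖ ≤ (1 + ‖u - a‖) * (1 + ‖u - b‖) := by
  have h : ‖a - b‖ ≤ ‖u - a‖ + ‖u - b‖ := by
    have := norm_sub_le (u - b) (u - a)
    rw [show u - b - (u - a) = a - b by abel] at this
    linarith
  nlinarith [norm_nonneg (u - a), norm_nonneg (u - b)]

lemma aux_smooth {n : ℕ} (Φ : SchwartzMap (En n) ℝ) (a b : En n) (N : ℕ∞) :
    ContDiff ℝ N (fun u : En n => ((Φ (u - a) * Φ (u - b) : ℝ) : ℂ)) := by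
  have h := Φ.smooth N
  refine Complex.ofRealCLM.contDiff.comp ?_
  exact (h.comp (contDiff_id.sub contDiff_const)).mul (h.comp (contDiff_id.sub contDiff_const))

lemma aux_deriv {n : ℕ} (Φ : SchwartzMap (En n) ℝ) (M : ℕ) :
    ∃ C : ℝ, 0 < C ∧ ∀ i ≤ M, ∀ a b u : En n,
      (1 + ‖a - b‖) ^ M *
        ‖iteratedFDeriv ℝ i (fun u : En n => ((Φ (u - a) * Φ (u - b) : ℝ) : ℂ)) u‖
        ≤ C * (1 + ‖u - a‖) ^ (-((n : ℝ) + 1)) := by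
  obtain ⟨C, hC, h⟩ := aux_decay Φ (M + (n + 1)) M
  refine ⟨2 ^ M * (C * C), by positivity, fun i hi a b u => ?_⟩
  have h1 : ‖iteratedFDeriv ℝ i (fun u : En n => ((Φ (u - a) * Φ (u - b) : ℝ) : ℂ)) u‖
      = ‖iteratedFDeriv ℝ i (fun u : En n => Φ (u - a) * Φ (u - b)) u‖ := by
    have hs : ContDiff ℝ (M : ℕ∞) (fun u : En n => Φ (u - a) * Φ (u - b)) := by
      have h := Φ.smooth M
      exact (h.comp (contDiff_id.sub contDiff_const)).mul
        (h.comp (contDiff_id.sub contDiff_const))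
    exact Complex.ofRealLI.norm_iteratedFDeriv_comp_left (f := fun u : En n => Φ (u - a) * Φ (u - b))
      (hs.contDiffAt (x := u)) (by exact_mod_cast hi)
  rw [h1]
  have hsa : ∀ a : En n, ContDiff ℝ (M : ℕ∞) (fun u : En n => Φ (u - a)) := fun a =>
    (Φ.smooth M).comp (contDiff_id.sub contDiff_const)
  have h2 := norm_iteratedFDeriv_mul_le (hsa a) (hsa b) u (n := i) (by exact_mod_cast hi)
  have hpos : 0 < (1 + ‖u - a‖) := by positivity
  rw [Real.rpow_neg hpos.le, ← div_eq_mul_inv, le_div_iff₀ (by positivity)]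
  rw [show ((n : ℝ) + 1) = ((n + 1 : ℕ) : ℝ) by push_cast; ring, Real.rpow_natCast]
  calc _ ≤ ((1 + ‖u - a‖) * (1 + ‖u - b‖)) ^ M * (∑ p ∈ Finset.range (i + 1),
      (i.choose p : ℝ) * ‖iteratedFDeriv ℝ p (fun u => Φ (u - a)) u‖
        * ‖iteratedFDeriv ℝ (i - p) (fun u => Φ (u - b)) u‖) * (1 + ‖u - a‖) ^ (n + 1) := by
        gcongr
        exact aux_tri a b u
    _ = ∑ p ∈ Finset.range (i + 1), (i.choose p : ℝ) *
        (((1 + ‖u - a‖) ^ (M + (n + 1)) * ‖iteratedFDeriv ℝ p Φ (u - a)‖) *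
        ((1 + ‖u - b‖) ^ M * ‖iteratedFDeriv ℝ (i - p) Φ (u - b)‖)) := by
        rw [Finset.mul_sum, Finset.sum_mul]
        refine Finset.sum_congr rfl fun p _ => ?_
        rw [iteratedFDeriv_comp_sub, iteratedFDeriv_comp_sub, mul_pow, pow_add]
        ring
    _ ≤ ∑ p ∈ Finset.range (i + 1), (i.choose p : ℝ) * (C * C) := by
        refine Finset.sum_le_sum fun p hp => ?_
        have hp' : p ≤ i := by simpa [Nat.lt_succ_iff] using hp
        gcongr
        · exact h p (hp'.trans hi) _
        · refine le_trans ?_ (h (i - p) (by omega) (u - b))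
          gcongr
          · linarith [norm_nonneg (u - b)]
          · omega
    _ = 2 ^ i * (C * C) := by
        rw [← Finset.sum_mul]
        congr 1
        exact_mod_cast Nat.sum_range_choose i
    _ ≤ _ := by
        gcongr
        norm_num

open scoped FourierTransform in
lemma aux_fourier {n : ℕ} (Φ : SchwartzMap (En n) ℝ) (M : ℕ) :
    ∃ C : ℝ, 0 < C ∧ ∀ a b ξ : En n,
      ‖∫ u : En n, Complex.exp (Complex.I * ((⟪u, ξ⟫ : ℝ) : ℂ)) *
        ((Φ (u - a) * Φ (u - b) : ℝ) : ℂ)‖ * ((1 + ‖a - b‖) ^ M * (1 + ‖ξ‖) ^ M) ≤ C := by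
  obtain ⟨C, hC, h⟩ := aux_deriv Φ M
  have hInteg0 : Integrable (fun u : En n => (1 + ‖u‖) ^ (-((n : ℝ) + 1))) :=
    integrable_one_add_norm (by simp)
  set B : ℝ := ∫ u : En n, (1 + ‖u‖) ^ (-((n : ℝ) + 1)) with hB
  have hB0 : 0 ≤ B := integral_nonneg fun u => by positivity
  -- integrability and integral bounds
  have hI : ∀ a b : En n, ∀ i ≤ M, Integrable (fun u => ‖iteratedFDeriv ℝ i
      (fun u : En n => ((Φ (u - a) * Φ (u - b) : ℝ) : ℂ)) u‖) := by
    intro a b i hi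
    refine Integrable.mono' ((hInteg0.comp_sub_right a).const_mul C) ?_ ?_
    · exact ((aux_smooth Φ a b M).continuous_iteratedFDeriv
        (by exact_mod_cast hi)).norm.aestronglyMeasurable
    · refine Filter.Eventually.of_forall fun u => ?_
      rw [norm_norm]
      refine le_trans ?_ (h i hi a b u)
      exact le_mul_of_one_le_left (norm_nonneg _)
        (one_le_pow₀ (by linarith [norm_nonneg (a - b)]))
  have hII : ∀ a b : En n, ∀ i ≤ M, (1 + ‖a - b‖) ^ M * (∫ u, ‖iteratedFDeriv ℝ i
      (fun u : En n => ((Φ (u - a) * Φ (u - b) : ℝ) : ℂ)) u‖) ≤ C * B := by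
    intro a b i hi
    rw [hB, ← integral_sub_right_eq_self (fun u : En n => (1 + ‖u‖) ^ (-((n : ℝ) + 1))) a,
      ← integral_const_mul, ← integral_const_mul]
    exact integral_mono ((hI a b i hi).const_mul _) ((hInteg0.comp_sub_right a).const_mul C)
      fun u => h i hi a b u
  have key : ∀ a b : En n, ∀ i ≤ M, ∀ w : En n,
      ‖w‖ ^ i * ‖𝓕 (fun u : En n => ((Φ (u - a) * Φ (u - b) : ℝ) : ℂ)) w‖ *
        (1 + ‖a - b‖) ^ M ≤ 2 ^ M * ((M + 1) * (C * B)) := by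
    intro a b i hi w
    have := Real.pow_mul_norm_iteratedFDeriv_fourier_le (K := 0) (N := M)
      (aux_smooth Φ a b M) (k := 0) (n := i) ?_ le_rfl (by exact_mod_cast hi) w
    · simp only [norm_iteratedFDeriv_zero, pow_zero, one_mul, Nat.cast_zero, mul_zero, zero_add,
        Finset.range_one, Finset.singleton_product, Finset.sum_map, Function.Embedding.coeFn_mk]
        at this
      calc _ ≤ (2 ^ i * ∑ p ∈ Finset.range (i + 1), ∫ u, ‖iteratedFDeriv ℝ p
              (fun u : En n => ((Φ (u - a) * Φ (u - b) : ℝ) : ℂ)) u‖) * (1 + ‖a - b‖) ^ M := by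
            gcongr
        _ = 2 ^ i * ∑ p ∈ Finset.range (i + 1), (1 + ‖a - b‖) ^ M * ∫ u, ‖iteratedFDeriv ℝ p
              (fun u : En n => ((Φ (u - a) * Φ (u - b) : ℝ) : ℂ)) u‖ := by
            rw [← Finset.mul_sum]; ring
        _ ≤ 2 ^ i * ∑ p ∈ Finset.range (i + 1), C * B := by
            refine mul_le_mul_of_nonneg_left (Finset.sum_le_sum fun p hp => ?_) (by positivity)
            refine hII a b p ?_
            have : p < i + 1 := by simpa using hp
            omega
        _ ≤ _ := by
            rw [Finset.sum_const, Finset.card_range, nsmul_eq_mul]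
            push_cast
            gcongr
            norm_num
    · intro k p hk hp
      have hk0 : k = 0 := by simpa using hk
      subst hk0
      simpa only [pow_zero, one_mul] using hI a b p (by exact_mod_cast hp)
  set D : ℝ := 2 ^ M * ((M + 1) * (C * B)) with hD
  have hD0 : 0 ≤ D := by positivity
  refine ⟨2 ^ M * (D + (2 * Real.pi) ^ M * D) + 1, by positivity, fun a b ξ => ?_⟩
  set w : En n := -((2 * Real.pi)⁻¹ • ξ) with hw
  have e1 : ∫ u : En n, Complex.exp (Complex.I * ((⟪u, ξ⟫ : ℝ) : ℂ)) *
        ((Φ (u - a) * Φ (u - b) : ℝ) : ℂ) =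
      𝓕 (fun u : En n => ((Φ (u - a) * Φ (u - b) : ℝ) : ℂ)) w := by
    rw [Real.fourier_eq']
    congr 1
    ext u
    rw [smul_eq_mul]
    congr 2
    rw [hw, inner_neg_right, inner_smul_right]
    have : (-2 * Real.pi * -((2 * Real.pi)⁻¹ * ⟪u, ξ⟫)) = ⟪u, ξ⟫ := by
      field_simp
    rw [this, mul_comm]
  rw [e1]
  have hξ : ‖ξ‖ = (2 * Real.pi) * ‖w‖ := by
    rw [hw, norm_neg, norm_smul, Real.norm_of_nonneg (by positivity)]
    field_simp
  have hp : (1 + ‖ξ‖) ^ M ≤ 2 ^ M * (1 + ‖ξ‖ ^ M) := by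
    have := add_pow_le (zero_le_one (α := ℝ)) (norm_nonneg ξ) M
    rw [one_pow] at this
    refine this.trans ?_
    gcongr
    · norm_num
    · omega
  have k0 := key a b 0 (Nat.zero_le _) w
  have k1 := key a b M le_rfl w
  rw [pow_zero, one_mul] at k0
  set X := ‖𝓕 (fun u : En n => ((Φ (u - a) * Φ (u - b) : ℝ) : ℂ)) w‖
  set Y := (1 + ‖a - b‖) ^ M
  have hX : 0 ≤ X := norm_nonneg _
  have hY : 0 ≤ Y := by positivity
  calc X * (Y * (1 + ‖ξ‖) ^ M) ≤ X * (Y * (2 ^ M * (1 + ‖ξ‖ ^ M))) := by gcongr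
    _ = 2 ^ M * (X * Y + (2 * Real.pi) ^ M * (‖w‖ ^ M * X * Y)) := by
        rw [hξ, mul_pow]; ring
    _ ≤ 2 ^ M * (D + (2 * Real.pi) ^ M * D) := by gcongr
    _ ≤ _ := by linarith

lemma aux_dil_sq (n j : ℕ) :
    (2 : ℝ) ^ ((n * j : ℝ) / 2) * (2 : ℝ) ^ ((n * j : ℝ) / 2) = ((2 : ℝ) ^ j) ^ n := by
  rw [← Real.rpow_add (by norm_num), add_halves, ← pow_mul, mul_comm j n,
    ← Real.rpow_natCast]
  push_cast
  rfl

lemma aux_scale {n : ℕ} {E : Type*} [NormedAddCommGroup E] [NormedSpace ℝ E] (j : ℕ)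
    (F : En n → E) :
    ∫ x : En n, ((2 : ℝ) ^ j) ^ n • F ((2 : ℝ) ^ j • x) = ∫ u, F u := by
  rw [integral_smul, Measure.integral_comp_smul, smul_smul, abs_of_nonneg (by positivity)]
  simp

lemma dil_continuous (n : ℕ) (Φ : SchwartzMap (En n) ℝ) (j : ℕ) (k : Fin n → ℤ) :
    Continuous (dil n Φ j k) := by
  unfold dil
  have := Φ.continuous
  fun_prop

lemma aux_osc {n : ℕ} (Φ : SchwartzMap (En n) ℝ) (M : ℕ) :
    ∃ C : ℝ, 0 < C ∧ ∀ (j : ℕ) (k k' : Fin n → ℤ) (z : En n),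
      ‖∫ x : En n, Complex.exp (Complex.I * ((⟪x, z⟫ : ℝ) : ℂ)) *
        ((dil n Φ j k x * dil n Φ j k' x : ℝ) : ℂ)‖ *
        ((1 + ‖intVec n (k - k')‖) ^ M * (1 + ((2 : ℝ) ^ j)⁻¹ * ‖z‖) ^ M) ≤ C := by
  obtain ⟨C, hC, h⟩ := aux_fourier Φ M
  refine ⟨C, hC, fun j k k' z => ?_⟩
  have := h (intVec n k) (intVec n k') (((2 : ℝ) ^ j)⁻¹ • z)
  rw [norm_smul, Real.norm_of_nonneg (by positivity), ← intVec_sub] at this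
  convert this using 3
  symm
  rw [← aux_scale j]
  congr 1
  ext x
  have e : ⟪(2 : ℝ) ^ j • x, ((2 : ℝ) ^ j)⁻¹ • z⟫ = ⟪x, z⟫ := by
    rw [inner_smul_left, inner_smul_right]
    simp
  rw [e]
  have e2 : dil n Φ j k x * dil n Φ j k' x = ((2 : ℝ) ^ j) ^ n *
      (Φ ((2 : ℝ) ^ j • x - intVec n k) * Φ ((2 : ℝ) ^ j • x - intVec n k')) := by
    rw [← aux_dil_sq]; unfold dil; ring
  rw [e2, Complex.real_smul]
  push_cast
  ring

lemma aux_psi_int {n : ℕ} (Φ : SchwartzMap (En n) ℝ) (j : ℕ) (k k' : Fin n → ℤ) :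
    Integrable (fun x : En n => ((dil n Φ j k x * dil n Φ j k' x : ℝ) : ℂ)) := by
  refine Integrable.ofReal ?_
  have h1 : ∀ k, MemLp (dil n Φ j k) 2 volume := by
    intro k
    have h := (Φ.memLp 2 (volume : Measure (En n)))
    rw [memLp_two_iff_integrable_sq (dil_continuous n Φ j k).aestronglyMeasurable]
    have h2 := h.integrable_sq
    have h3 := (h2.comp_sub_right (intVec n k)).comp_smul (R := (2 : ℝ) ^ j) (by positivity)
    have h4 := h3.const_mul (((2 : ℝ) ^ ((n * j : ℝ) / 2)) ^ 2)
    refine h4.congr (Filter.Eventually.of_forall fun x => ?_)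
    simp only [dil]
    ring
  exact (h1 k).integrable_mul (h1 k')

lemma aux_norm_sq {n : ℕ} (g : L2 n) (hg : ‖g‖ = 1) :
    Integrable (fun y : En n => ‖g y‖ ^ 2) ∧ ∫ y : En n, ‖g y‖ ^ 2 = 1 := by
  refine ⟨(Lp.memLp g).integrable_norm_pow (by norm_num), ?_⟩
  have h := inner_self_eq_norm_sq_to_K (𝕜 := ℂ) g
  rw [L2.inner_def, hg] at h
  simp only [inner_self_eq_norm_sq_to_K] at h
  have h2 : ∫ y : En n, ((‖g y‖ ^ 2 : ℝ) : ℂ) = 1 := by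
    simpa using h
  rw [integral_complex_ofReal] at h2
  exact_mod_cast h2

lemma aux_weight {n : ℕ} (Φ : SchwartzMap (En n) ℝ) (M : ℕ) :
    ∃ B : ℝ, 0 < B ∧ ∀ (j : ℕ) (l : Fin n → ℤ) (g : L2 n), ‖g‖ = 1 →
      Integrable (fun y : En n => (1 + ‖(2 : ℝ) ^ j • y - intVec n l‖) ^ M *
        (|dil n Φ j l y| * ‖g y‖)) ∧
      ∫ y : En n, (1 + ‖(2 : ℝ) ^ j • y - intVec n l‖) ^ M *
        (|dil n Φ j l y| * ‖g y‖) ≤ B := by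
  obtain ⟨C, hC, h⟩ := aux_decay Φ (M + (n + 1)) 0
  have hInteg0 : Integrable (fun u : En n => (1 + ‖u‖) ^ (-((n : ℝ) + 1))) :=
    integrable_one_add_norm (by simp)
  have hΦc := Φ.continuous
  have hP : Integrable (fun v : En n => ((1 + ‖v‖) ^ M * |Φ v|) ^ 2) := by
    refine Integrable.mono' (hInteg0.const_mul (C * C)) ?_ ?_
    · exact Continuous.aestronglyMeasurable (by fun_prop)
    · refine Filter.Eventually.of_forall fun v => ?_
      have h1 := h 0 le_rfl v
      rw [norm_iteratedFDeriv_zero, Real.norm_eq_abs, pow_add] at h1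
      have hp : 0 < (1 + ‖v‖) := by positivity
      have hp1 : 1 ≤ (1 + ‖v‖) ^ (n + 1) := one_le_pow₀ (by linarith [norm_nonneg v])
      rw [Real.norm_of_nonneg (by positivity), Real.rpow_neg hp.le, ← div_eq_mul_inv,
        le_div_iff₀ (by positivity),
        show ((n : ℝ) + 1) = ((n + 1 : ℕ) : ℝ) by push_cast; ring, Real.rpow_natCast]
      have h2 : (1 + ‖v‖) ^ M * |Φ v| ≤ C := by
        refine le_trans ?_ h1
        have : 0 ≤ (1 + ‖v‖) ^ M * |Φ v| := by positivity
        nlinarith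
      calc _ = ((1 + ‖v‖) ^ M * |Φ v|) * ((1 + ‖v‖) ^ M * (1 + ‖v‖) ^ (n + 1) * |Φ v|) := by ring
        _ ≤ C * C := by gcongr
  set B : ℝ := ∫ v : En n, ((1 + ‖v‖) ^ M * |Φ v|) ^ 2 with hB
  have hB0 : 0 ≤ B := integral_nonneg fun u => by positivity
  refine ⟨B + 1, by positivity, fun j l g hg => ?_⟩
  obtain ⟨hg1, hg2⟩ := aux_norm_sq g hg
  have hA : ∀ y : En n, ((1 + ‖(2 : ℝ) ^ j • y - intVec n l‖) ^ M * |dil n Φ j l y|) ^ 2 =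
      ((2 : ℝ) ^ j) ^ n • (fun u : En n => ((1 + ‖u - intVec n l‖) ^ M * |Φ (u - intVec n l)|) ^ 2)
        ((2 : ℝ) ^ j • y) := by
    intro y
    rw [← aux_dil_sq, smul_eq_mul]
    unfold dil
    rw [abs_mul, abs_of_nonneg (by positivity : (0:ℝ) ≤ (2 : ℝ) ^ ((n * j : ℝ) / 2))]
    ring
  have hAint : Integrable (fun y : En n =>
      ((1 + ‖(2 : ℝ) ^ j • y - intVec n l‖) ^ M * |dil n Φ j l y|) ^ 2) := by
    simp_rw [hA]
    exact ((hP.comp_sub_right (intVec n l)).comp_smul (R := (2 : ℝ) ^ j) (by positivity)).smul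
      (((2 : ℝ) ^ j) ^ n)
  have hAB : ∫ y : En n,
      ((1 + ‖(2 : ℝ) ^ j • y - intVec n l‖) ^ M * |dil n Φ j l y|) ^ 2 = B := by
    simp_rw [hA]
    rw [aux_scale j (fun u : En n => ((1 + ‖u - intVec n l‖) ^ M * |Φ (u - intVec n l)|) ^ 2),
      integral_sub_right_eq_self (fun u : En n => ((1 + ‖u‖) ^ M * |Φ u|) ^ 2)]
  have hle : ∀ y : En n, (1 + ‖(2 : ℝ) ^ j • y - intVec n l‖) ^ M * (|dil n Φ j l y| * ‖g y‖) ≤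
      ((1 + ‖(2 : ℝ) ^ j • y - intVec n l‖) ^ M * |dil n Φ j l y|) ^ 2 + ‖g y‖ ^ 2 := by
    intro y
    rw [← mul_assoc]
    set s := (1 + ‖(2 : ℝ) ^ j • y - intVec n l‖) ^ M * |dil n Φ j l y|
    nlinarith [sq_nonneg (s - ‖g y‖), sq_nonneg s, sq_nonneg ‖g y‖]
  have hdc := dil_continuous n Φ j l
  have hI : Integrable (fun y : En n => (1 + ‖(2 : ℝ) ^ j • y - intVec n l‖) ^ M *
        (|dil n Φ j l y| * ‖g y‖)) := by
    refine Integrable.mono' (hAint.add hg1) ?_ ?_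
    · refine AEStronglyMeasurable.mul (Continuous.aestronglyMeasurable (by fun_prop)) ?_
      exact AEStronglyMeasurable.mul (Continuous.aestronglyMeasurable (by fun_prop))
        (Lp.aestronglyMeasurable g).norm
    · refine Filter.Eventually.of_forall fun y => ?_
      rw [Real.norm_of_nonneg (by positivity)]
      exact hle y
  refine ⟨hI, ?_⟩
  calc _ ≤ ∫ y, (((1 + ‖(2 : ℝ) ^ j • y - intVec n l‖) ^ M * |dil n Φ j l y|) ^ 2 + ‖g y‖ ^ 2) :=
        integral_mono hI (hAint.add hg1) hle
    _ = B + 1 := by rw [integral_add hAint hg1, hAB, hg2]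

lemma aux_exp {n : ℕ} (x y y' : En n) :
    (starRingEnd ℂ) (Complex.exp (Complex.I * ((⟪x, y⟫ : ℝ) : ℂ))) *
      Complex.exp (Complex.I * ((⟪x, y'⟫ : ℝ) : ℂ)) =
    Complex.exp (Complex.I * ((⟪x, y' - y⟫ : ℝ) : ℂ)) := by
  rw [← Complex.exp_conj, ← Complex.exp_add, inner_sub_right]
  congr 1
  simp
  ring

lemma aux_exp_norm (t : ℝ) : ‖Complex.exp (Complex.I * (t : ℂ))‖ = 1 := by
  rw [mul_comm]; exact Complex.norm_exp_ofReal_mul_I t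

lemma aux_fubini {n : ℕ} (ψ F G : En n → ℂ) (hψ : Integrable ψ) (hF : Integrable F)
    (hG : Integrable G) :
    ∫ x : En n, ψ x * ((starRingEnd ℂ) (∫ y : En n, Complex.exp (Complex.I * ((⟪x, y⟫ : ℝ) : ℂ)) * F y) *
      ∫ y : En n, Complex.exp (Complex.I * ((⟪x, y⟫ : ℝ) : ℂ)) * G y) =
    ∫ p : En n × En n, ((starRingEnd ℂ) (F p.1) * G p.2) *
      ∫ x : En n, Complex.exp (Complex.I * ((⟪x, p.2 - p.1⟫ : ℝ) : ℂ)) * ψ x := by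
  have e1 : ∀ x : En n, ψ x * ((starRingEnd ℂ) (∫ y : En n,
      Complex.exp (Complex.I * ((⟪x, y⟫ : ℝ) : ℂ)) * F y) *
      ∫ y : En n, Complex.exp (Complex.I * ((⟪x, y⟫ : ℝ) : ℂ)) * G y) =
      ∫ p : En n × En n, Complex.exp (Complex.I * ((⟪x, p.2 - p.1⟫ : ℝ) : ℂ)) *
        (ψ x * ((starRingEnd ℂ) (F p.1) * G p.2)) := by
    intro x
    rw [← integral_conj, ← integral_prod_mul, ← integral_const_mul]
    congr 1
    ext p
    rw [← aux_exp, map_mul]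
    ring
  simp_rw [e1]
  rw [integral_integral_swap]
  · congr 1
    ext p
    rw [← integral_const_mul]
    congr 1
    ext x
    ring
  · have hF' : Integrable (fun y => (starRingEnd ℂ) (F y)) :=
      (Complex.conjLIE.toContinuousLinearEquiv.toContinuousLinearMap).integrable_comp hF
    have := hψ.mul_prod (hF'.mul_prod hG)
    refine Integrable.bdd_mul (c := 1) this ?_ ?_
    · exact Continuous.aestronglyMeasurable (by fun_prop)
    · exact Filter.Eventually.of_forall fun q => (aux_exp_norm _).le

lemma aux_rpow (t N : ℝ) (M : ℕ) (ht : 0 ≤ t) (hM : 2 * N ≤ M) :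
    ((1 + t) ^ M)⁻¹ ≤ (1 + t) ^ (-(2 * N)) := by
  rw [← Real.rpow_natCast, ← Real.rpow_neg (by positivity)]
  exact Real.rpow_le_rpow_of_exponent_le (by linarith) (by linarith)

lemma aux_tri2 {n : ℕ} (j : ℕ) (a b y y' : En n) :
    1 + ((4 : ℝ) ^ j)⁻¹ * ‖a - b‖ ≤ (1 + ‖(2 : ℝ) ^ j • y - a‖) * (1 + ‖(2 : ℝ) ^ j • y' - b‖) *
      (1 + ((2 : ℝ) ^ j)⁻¹ * ‖y' - y‖) := by
  have h4 : ((4 : ℝ) ^ j)⁻¹ = ((2 : ℝ) ^ j)⁻¹ * ((2 : ℝ) ^ j)⁻¹ := by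
    rw [← mul_inv, ← mul_pow]; norm_num
  have h41 : ((4 : ℝ) ^ j)⁻¹ ≤ 1 := inv_le_one_of_one_le₀ (one_le_pow₀ (by norm_num))
  have h40 : 0 ≤ ((4 : ℝ) ^ j)⁻¹ := by positivity
  have h : ‖a - b‖ ≤ ‖(2 : ℝ) ^ j • y - a‖ + ‖(2 : ℝ) ^ j • y' - b‖ + (2 : ℝ) ^ j * ‖y' - y‖ := by
    have e : a - b = -((2 : ℝ) ^ j • y - a) + ((2 : ℝ) ^ j • y' - b) - (2 : ℝ) ^ j • (y' - y) := by
      rw [smul_sub]; abel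
    rw [e]
    refine (norm_sub_le _ _).trans ?_
    refine add_le_add ((norm_add_le _ _).trans (by rw [norm_neg])) ?_
    rw [norm_smul, Real.norm_of_nonneg (by positivity)]
  set p := ‖(2 : ℝ) ^ j • y - a‖
  set q := ‖(2 : ℝ) ^ j • y' - b‖
  have hp : 0 ≤ p := norm_nonneg _
  have hq : 0 ≤ q := norm_nonneg _
  set r := ((2 : ℝ) ^ j)⁻¹ * ‖y' - y‖ with hr
  have hr0 : 0 ≤ r := by positivity
  have hrr : ((4 : ℝ) ^ j)⁻¹ * ((2 : ℝ) ^ j * ‖y' - y‖) = r := by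
    rw [h4, hr]; field_simp
  have h5 : ((4 : ℝ) ^ j)⁻¹ * ‖a - b‖ ≤ p + q + r := by
    calc _ ≤ ((4 : ℝ) ^ j)⁻¹ * (p + q + (2 : ℝ) ^ j * ‖y' - y‖) := by gcongr
      _ = ((4 : ℝ) ^ j)⁻¹ * (p + q) + r := by rw [mul_add, hrr]
      _ ≤ 1 * (p + q) + r := by gcongr
      _ = _ := by ring
  have : 1 + (p + q + r) ≤ (1 + p) * (1 + q) * (1 + r) := by
    have h1 := mul_nonneg hp hq
    have h2 := mul_nonneg hp hr0
    have h3 := mul_nonneg hq hr0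
    have h4 := mul_nonneg h1 hr0
    nlinarith
  linarith

set_option maxHeartbeats 2000000 in
/-- For real-valued Schwartz functions `Φ1, Φ2` and the operators
`T_{j,k,l} f(x) = ∫ e^{i x·y} Φ1_{j,k}(x) Φ2_{j,l}(y) f(y) dy` on `L²(ℝⁿ)`:
for every `N₀ > n` there is a constant `C`, depending only on `Φ1, Φ2, n, N₀`, such that
`‖T*_{j,k,l} T_{j,k′,l′}‖ ≤ C (1+|k−k′|)^{−2N₀} (1+4^{−j}|l−l′|)^{−2N₀}`. -/
theorem stmt_3 (n : ℕ) (hn : 1 ≤ n) (Φ1 Φ2 : SchwartzMap (En n) ℝ)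
    (N₀ : ℝ) (hN₀ : (n : ℝ) < N₀) :
    ∃ C : ℝ, 0 < C ∧ ∀ (j : ℕ)
      (T : (Fin n → ℤ) → (Fin n → ℤ) → L2 n →L[ℂ] L2 n),
      (∀ (k l : Fin n → ℤ) (f : L2 n), ∀ᵐ x : En n,
        T k l f x = ∫ y : En n, Complex.exp (Complex.I * ((⟪x, y⟫ : ℝ) : ℂ)) *
          ((dil n Φ1 j k x : ℝ) : ℂ) * ((dil n Φ2 j l y : ℝ) : ℂ) * f y) →
      ∀ k k' l l' : Fin n → ℤ,
        ‖(adjoint (T k l)).comp (T k' l')‖ ≤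
          C * (1 + ‖intVec n (k - k')‖) ^ (-(2 * N₀)) *
            (1 + ((4 : ℝ) ^ j)⁻¹ * ‖intVec n (l - l')‖) ^ (-(2 * N₀)) := by
  obtain ⟨M, hM⟩ := exists_nat_ge (2 * N₀)
  obtain ⟨C, hC, hosc⟩ := aux_osc Φ1 M
  obtain ⟨B, hB, hw⟩ := aux_weight Φ2 M
  refine ⟨C * (B * B), by positivity, fun j T hT k k' l l' => ?_⟩
  refine opNorm_le_of_re_inner_le (𝕜 := ℂ) (by positivity) fun f g hf hg => ?_
  rw [comp_apply, adjoint_inner_left]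
  refine (Complex.re_le_norm _).trans ?_
  obtain ⟨hfI, hfB⟩ := hw j l' f hf
  obtain ⟨hgI, hgB⟩ := hw j l g hg
  set F : En n → ℂ := fun y => ((dil n Φ2 j l' y : ℝ) : ℂ) * f y with hFdef
  set G : En n → ℂ := fun y => ((dil n Φ2 j l y : ℝ) : ℂ) * g y with hGdef
  have hInteg : ∀ (l : Fin n → ℤ) (f : L2 n), Integrable (fun y : En n =>
      (1 + ‖(2 : ℝ) ^ j • y - intVec n l‖) ^ M * (|dil n Φ2 j l y| * ‖f y‖)) →
      Integrable (fun y : En n => ((dil n Φ2 j l y : ℝ) : ℂ) * f y) := by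
    intro l f h
    refine h.mono' ?_ ?_
    · exact AEStronglyMeasurable.mul (Complex.continuous_ofReal.comp
        (dil_continuous n Φ2 j l)).aestronglyMeasurable (Lp.aestronglyMeasurable f)
    · refine Filter.Eventually.of_forall fun y => ?_
      rw [norm_mul, Complex.norm_real, Real.norm_eq_abs]
      exact le_mul_of_one_le_left (by positivity)
        (one_le_pow₀ (by linarith [norm_nonneg ((2 : ℝ) ^ j • y - intVec n l)]))
  have hFi : Integrable F := hInteg l' f hfI
  have hGi : Integrable G := hInteg l g hgI
  have hker : ∀ (k l : Fin n → ℤ) (f : L2 n) (x : En n),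
      (∫ y : En n, Complex.exp (Complex.I * ((⟪x, y⟫ : ℝ) : ℂ)) *
          ((dil n Φ1 j k x : ℝ) : ℂ) * ((dil n Φ2 j l y : ℝ) : ℂ) * f y) =
      ((dil n Φ1 j k x : ℝ) : ℂ) * ∫ y : En n, Complex.exp (Complex.I * ((⟪x, y⟫ : ℝ) : ℂ)) *
        (((dil n Φ2 j l y : ℝ) : ℂ) * f y) := by
    intro k l f x
    rw [← integral_const_mul]
    congr 1
    ext y
    ring
  have hid : inner ℂ (T k' l' f) (T k l g) =
      ∫ p : En n × En n, ((starRingEnd ℂ) (F p.1) * G p.2) *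
        ∫ x : En n, Complex.exp (Complex.I * ((⟪x, p.2 - p.1⟫ : ℝ) : ℂ)) *
          ((dil n Φ1 j k x * dil n Φ1 j k' x : ℝ) : ℂ) := by
    rw [← aux_fubini _ F G (aux_psi_int Φ1 j k k') hFi hGi, L2.inner_def]
    refine integral_congr_ae ?_
    filter_upwards [hT k' l' f, hT k l g] with x h1 h2
    rw [h1, h2, hker, hker, RCLike.inner_apply, map_mul, Complex.conj_ofReal]
    push_cast
    ring
  rw [hid]
  set X : ℝ := 1 + ‖intVec n (k - k')‖ with hX
  set Y : ℝ := 1 + ((4 : ℝ) ^ j)⁻¹ * ‖intVec n (l - l')‖ with hY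
  have hX0 : 0 < X := by positivity
  have hY0 : 0 < Y := by positivity
  have hpt : ∀ p : En n × En n, ‖((starRingEnd ℂ) (F p.1) * G p.2) *
        ∫ x : En n, Complex.exp (Complex.I * ((⟪x, p.2 - p.1⟫ : ℝ) : ℂ)) *
          ((dil n Φ1 j k x * dil n Φ1 j k' x : ℝ) : ℂ)‖ ≤
      (C * ((X ^ M)⁻¹ * (Y ^ M)⁻¹)) *
        (((1 + ‖(2 : ℝ) ^ j • p.1 - intVec n l'‖) ^ M * (|dil n Φ2 j l' p.1| * ‖f p.1‖)) *
         ((1 + ‖(2 : ℝ) ^ j • p.2 - intVec n l‖) ^ M * (|dil n Φ2 j l p.2| * ‖g p.2‖))) := by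
    intro p
    have ho := hosc j k k' (p.2 - p.1)
    have ht := aux_tri2 j (intVec n l') (intVec n l) p.1 p.2
    rw [← norm_neg, neg_sub, ← intVec_sub, ← hY] at ht
    rw [norm_mul, norm_mul, RCLike.norm_conj]
    have hFn : ‖F p.1‖ = |dil n Φ2 j l' p.1| * ‖f p.1‖ := by
      rw [hFdef]; simp only [norm_mul, Complex.norm_real, Real.norm_eq_abs]
    have hGn : ‖G p.2‖ = |dil n Φ2 j l p.2| * ‖g p.2‖ := by
      rw [hGdef]; simp only [norm_mul, Complex.norm_real, Real.norm_eq_abs]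
    rw [← hFn, ← hGn]
    set O := ‖∫ x : En n, Complex.exp (Complex.I * ((⟪x, p.2 - p.1⟫ : ℝ) : ℂ)) *
          ((dil n Φ1 j k x * dil n Φ1 j k' x : ℝ) : ℂ)‖
    have hO : 0 ≤ O := norm_nonneg _
    set P := 1 + ‖(2 : ℝ) ^ j • p.1 - intVec n l'‖
    set Q := 1 + ‖(2 : ℝ) ^ j • p.2 - intVec n l‖
    set R := 1 + ((2 : ℝ) ^ j)⁻¹ * ‖p.2 - p.1‖
    have hP0 : 0 < P := by positivity
    have hQ0 : 0 < Q := by positivity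
    have hR0 : 0 < R := by positivity
    have hYM : Y ^ M ≤ (P * Q * R) ^ M := by gcongr
    have hmain : O * (X ^ M * Y ^ M) ≤ C * (P ^ M * Q ^ M) := by
      calc O * (X ^ M * Y ^ M) ≤ O * (X ^ M * (P * Q * R) ^ M) := by gcongr
        _ = O * (X ^ M * R ^ M) * (P ^ M * Q ^ M) := by rw [mul_pow, mul_pow]; ring
        _ ≤ _ := by gcongr
    have hO2 : O ≤ C * (P ^ M * Q ^ M) * ((X ^ M)⁻¹ * (Y ^ M)⁻¹) := by
      rw [← mul_inv, ← div_eq_mul_inv, le_div_iff₀ (by positivity)]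
      exact hmain
    calc _ ≤ ‖F p.1‖ * ‖G p.2‖ * (C * (P ^ M * Q ^ M) * ((X ^ M)⁻¹ * (Y ^ M)⁻¹)) := by gcongr
      _ = _ := by ring
  have hprod := (hfI.mul_prod hgI).const_mul (C * ((X ^ M)⁻¹ * (Y ^ M)⁻¹))
  refine (norm_integral_le_of_norm_le hprod (Filter.Eventually.of_forall hpt)).trans ?_
  rw [integral_const_mul, integral_prod_mul
    (fun y : En n => (1 + ‖(2 : ℝ) ^ j • y - intVec n l'‖) ^ M * (|dil n Φ2 j l' y| * ‖f y‖))
    (fun y : En n => (1 + ‖(2 : ℝ) ^ j • y - intVec n l‖) ^ M * (|dil n Φ2 j l y| * ‖g y‖))]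
  have hXr : (X ^ M)⁻¹ ≤ X ^ (-(2 * N₀)) := aux_rpow _ _ _ (norm_nonneg _) hM
  have hYr : (Y ^ M)⁻¹ ≤ Y ^ (-(2 * N₀)) := aux_rpow _ _ _ (by positivity) hM
  calc _ ≤ C * (X ^ (-(2 * N₀)) * Y ^ (-(2 * N₀))) * (B * B) := by
        have hg0 : 0 ≤ ∫ y : En n, (1 + ‖(2 : ℝ) ^ j • y - intVec n l‖) ^ M *
          (|dil n Φ2 j l y| * ‖g y‖) := integral_nonneg fun y => by positivity
        gcongr
    _ = _ := by ring
end
end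

section
/- Let Φ¹, Φ² be real-valued Schwartz functions on ℝⁿ, let j ≥ 0 be an integer, and let {a_{k,l}}_{(k,l)∈ℤⁿ×ℤⁿ} be complex numbers with sup_{k,l} |a_{k,l}| < ∞. For (k,l) ∈ ℤⁿ×ℤⁿ define T_{j,k,l} on L²(ℝⁿ) by T_{j,k,l}f(x) = ∫_{ℝⁿ} e^{i x·y} Φ¹_{j,k}(x) Φ²_{j,l}(y) f(y) dy. Then for every f ∈ L²(ℝⁿ) the series ∑_{(k,l)∈ℤ^{2n}} a_{k,l} T_{j,k,l} f converges in L²(ℝⁿ), and the resulting operator is bounded on L²(ℝⁿ) with operator norm at most C · 4^{jn} · sup_{k,l}|a_{k,l}|, where C depends only on Φ¹, Φ² and n. -/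
open MeasureTheory Complex
open scoped RealInnerProductSpace

noncomputable section

namespace Stmt5
open Real

/-- product weight -/
def wt (n : ℕ) (x : En n) : ℝ := ∏ i, (1 + (x i) ^ 2)

lemma one_le_wt {n : ℕ} (x : En n) : 1 ≤ wt n x := by
  unfold wt
  calc (1:ℝ) = ∏ i : Fin n, (1:ℝ) := by simp
    _ ≤ _ := Finset.prod_le_prod (by simp) (fun i _ => by nlinarith [sq_nonneg (x i)])

lemma wt_pos {n : ℕ} (x : En n) : 0 < wt n x := lt_of_lt_of_le one_pos (one_le_wt x)

lemma wt_add {n : ℕ} (a b : En n) : wt n (a + b) ≤ 2 ^ n * wt n a * wt n b := by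
  unfold wt
  calc ∏ i, (1 + ((a + b) i) ^ 2) ≤ ∏ i : Fin n, (2 * (1 + a i ^ 2) * (1 + b i ^ 2)) := by
        refine Finset.prod_le_prod (fun i _ => by positivity) (fun i _ => ?_)
        simp only [PiLp.add_apply]
        nlinarith [sq_nonneg (a i - b i), sq_nonneg (a i * b i), sq_nonneg (a i), sq_nonneg (b i)]
    _ = _ := by
        rw [Finset.prod_mul_distrib, Finset.prod_mul_distrib]; simp

lemma wt_neg {n : ℕ} (a : En n) : wt n (-a) = wt n a := by simp [wt]

lemma wt_smul_le {n : ℕ} (c : ℝ) (hc : |c| ≤ 1) (x : En n) : wt n (c • x) ≤ wt n x := by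
  unfold wt
  refine Finset.prod_le_prod (fun i _ => by positivity) (fun i _ => ?_)
  simp only [PiLp.smul_apply, smul_eq_mul, mul_pow]
  have : c ^ 2 ≤ 1 := by rw [← sq_abs]; exact pow_le_one₀ (abs_nonneg _) hc
  nlinarith [sq_nonneg (x i)]

lemma wt_le {n : ℕ} (x : En n) : wt n x ≤ (1 + ‖x‖ ^ 2) ^ n := by
  unfold wt
  calc ∏ i, (1 + (x i) ^ 2) ≤ ∏ i : Fin n, (1 + ‖x‖ ^ 2) := by
        refine Finset.prod_le_prod (fun i _ => by positivity) (fun i _ => ?_)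
        have := PiLp.norm_apply_le x i
        have h2 : (x i)^2 ≤ ‖x‖^2 := by
          rw [← sq_abs]; exact pow_le_pow_left₀ (abs_nonneg _) this 2
        linarith
    _ = _ := by simp

lemma continuous_wt {n : ℕ} : Continuous (wt n) := by
  unfold wt; fun_prop

def rho (n : ℕ) (x : En n) : ℝ := (wt n x)⁻¹

lemma rho_pos {n : ℕ} (x : En n) : 0 < rho n x := inv_pos.2 (wt_pos x)
lemma rho_le_one {n : ℕ} (x : En n) : rho n x ≤ 1 := inv_le_one_of_one_le₀ (one_le_wt x)
lemma continuous_rho {n : ℕ} : Continuous (rho n) :=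
  continuous_wt.inv₀ (fun x => (wt_pos x).ne')

lemma integrable_rho {n : ℕ} : Integrable (rho n) := by
  have h1 : Integrable (fun x : Fin n → ℝ => ∏ i, (fun t : ℝ => (1 + t^2)⁻¹) (x i)) :=
    Integrable.fintype_prod (fun i => integrable_inv_one_add_sq)
  have h2 := (PiLp.volume_preserving_ofLp (Fin n)).integrable_comp_emb
    (MeasurableEquiv.toLp 2 (Fin n → ℝ)).symm.measurableEmbedding (g := fun x : Fin n → ℝ => ∏ i, (fun t : ℝ => (1 + t^2)⁻¹) (x i))
  have h3 := h2.2 h1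
  refine h3.congr (Filter.Eventually.of_forall fun x => ?_)
  simp [rho, wt]

lemma sum_one (δ : ℝ) (h0 : 0 < δ) (h1 : δ ≤ 1) (s : ℝ) (M : ℕ) :
    ∑ k ∈ Finset.Ico (-(M:ℤ)) M, (1 + (s + δ * (k:ℝ))^2)⁻¹ ≤ 3 * π / δ := by
  have key : ∀ a : ℝ, (1 + a^2)⁻¹ ≤ 3 / δ * (Real.arctan (a + δ) - Real.arctan a) := by
    intro a
    obtain ⟨c, hc, h⟩ := exists_deriv_eq_slope Real.arctan (show a < a + δ by linarith)
      continuous_arctan.continuousOn (differentiable_arctan.differentiableOn)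
    rw [Real.deriv_arctan] at h; dsimp only at h
    have h2 : Real.arctan (a + δ) - Real.arctan a = δ * (1 / (1 + c^2)) := by
      rw [h]; field_simp; ring_nf; field_simp
    rw [h2]
    have e : 3 / δ * (δ * (1 / (1 + c^2))) = 3 / (1 + c^2) := by field_simp
    rw [e, inv_eq_one_div, div_le_div_iff₀ (by positivity) (by positivity)]
    obtain ⟨hc1, hc2⟩ := hc
    nlinarith [sq_nonneg (c - 2 * a), mul_nonneg (sub_nonneg.2 hc1.le) (sub_nonneg.2 hc2.le), sq_nonneg (c-a)]
  have tel : ∀ M : ℕ, ∑ k ∈ Finset.Ico (-(M:ℤ)) M, (Real.arctan (s + δ * (k:ℝ) + δ) - Real.arctan (s + δ * (k:ℝ)))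
      = Real.arctan (s + δ * M) - Real.arctan (s - δ * M) := by
    intro M
    induction M with
    | zero => simp
    | succ m ih =>
      have : Finset.Ico (-((m+1:ℕ):ℤ)) ((m+1:ℕ):ℤ) = insert (-((m:ℤ)+1)) (insert (m:ℤ) (Finset.Ico (-(m:ℤ)) m)) := by
        ext k; simp only [Finset.mem_Ico, Finset.mem_insert]; push_cast; omega
      rw [this, Finset.sum_insert, Finset.sum_insert, ih]
      · push_cast
        rw [show s + δ * (-((m:ℝ)+1)) + δ = s - δ * m by ring, show s + δ * (m:ℝ) + δ = s + δ * (m+1) by ring,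
          show s + δ * (-((m:ℝ)+1)) = s - δ * (m+1) by ring]
        ring
      · simp
      · simp
  calc _ ≤ ∑ k ∈ Finset.Ico (-(M:ℤ)) M, 3 / δ * (Real.arctan (s + δ * (k:ℝ) + δ) - Real.arctan (s + δ * (k:ℝ))) :=
        Finset.sum_le_sum fun k _ => key _
    _ = 3 / δ * (Real.arctan (s + δ * M) - Real.arctan (s - δ * M)) := by rw [← Finset.mul_sum, tel]
    _ ≤ 3 / δ * π := by
        gcongr
        linarith [arctan_lt_pi_div_two (s + δ * M), neg_pi_div_two_lt_arctan (s - δ * M)]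
    _ = _ := by ring

lemma intVec_apply {n : ℕ} (k : Fin n → ℤ) (i : Fin n) : intVec n k i = (k i : ℝ) := by
  simp [intVec]

lemma sum_rho {n : ℕ} (δ : ℝ) (h0 : 0 < δ) (h1 : δ ≤ 1) (s : En n) (F : Finset (Fin n → ℤ)) :
    ∑ k ∈ F, rho n (s + δ • intVec n k) ≤ (3 * π / δ) ^ n := by
  classical
  obtain ⟨M, hM⟩ : ∃ M : ℕ, F ⊆ Fintype.piFinset (fun _ : Fin n => Finset.Ico (-(M:ℤ)) M) := by
    refine ⟨(∑ k ∈ F, ∑ i, (k i).natAbs) + 1, fun k hk => ?_⟩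
    rw [Fintype.mem_piFinset]
    intro i
    have a1 : (k i).natAbs ≤ ∑ i, (k i).natAbs :=
      Finset.single_le_sum (f := fun i => (k i).natAbs) (fun _ _ => Nat.zero_le _) (Finset.mem_univ i)
    have a2 : ∑ i, (k i).natAbs ≤ ∑ k ∈ F, ∑ i, (k i).natAbs :=
      Finset.single_le_sum (f := fun k : Fin n → ℤ => ∑ i, (k i).natAbs) (fun _ _ => Nat.zero_le _) hk
    rw [Finset.mem_Ico]; omega
  calc _ ≤ ∑ k ∈ Fintype.piFinset (fun _ : Fin n => Finset.Ico (-(M:ℤ)) M), rho n (s + δ • intVec n k) :=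
        Finset.sum_le_sum_of_subset_of_nonneg hM (fun _ _ _ => (rho_pos _).le)
    _ = ∏ i : Fin n, ∑ k ∈ Finset.Ico (-(M:ℤ)) M, (1 + (s i + δ * (k:ℝ))^2)⁻¹ := by
        rw [Finset.prod_univ_sum]
        refine Finset.sum_congr rfl fun k _ => ?_
        simp [rho, wt, intVec_apply]
    _ ≤ ∏ i : Fin n, (3 * π / δ) :=
        Finset.prod_le_prod (fun i _ => Finset.sum_nonneg fun _ _ => by positivity) (fun i _ => sum_one δ h0 h1 _ M)
    _ = _ := by rw [Finset.prod_const]; simp only [Finset.card_univ, Fintype.card_fin]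

lemma schwartz_decay {n : ℕ} (φ : SchwartzMap (En n) ℂ) (m : ℕ) :
    ∃ C : ℝ, 0 ≤ C ∧ ∀ x, ‖φ x‖ ≤ C * rho n x ^ m := by
  refine ⟨2 ^ (2*n*m) * (Finset.Iic (2*n*m, 0)).sup (fun m => SchwartzMap.seminorm ℂ m.1 m.2) φ, by positivity, fun x => ?_⟩
  have h := SchwartzMap.one_add_le_sup_seminorm_apply (𝕜 := ℂ) (m := (2*n*m,0)) (k := 2*n*m) (n := 0) le_rfl le_rfl φ x
  rw [norm_iteratedFDeriv_zero] at h
  have hw : wt n x ^ m ≤ (1 + ‖x‖)^(2*n*m) := by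
    calc wt n x ^ m ≤ ((1 + ‖x‖^2)^n)^m := pow_le_pow_left₀ (wt_pos x).le (wt_le x) m
      _ ≤ (((1 + ‖x‖)^2)^n)^m := by
          gcongr; nlinarith [norm_nonneg x]
      _ = _ := by rw [← pow_mul, ← pow_mul, mul_assoc]
  rw [rho, inv_pow, ← div_eq_mul_inv, le_div_iff₀ (pow_pos (wt_pos x) m)]
  calc ‖φ x‖ * wt n x ^ m ≤ ‖φ x‖ * (1 + ‖x‖)^(2*n*m) := by gcongr
    _ ≤ _ := by rw [mul_comm]; exact h

end Stmt5

namespace Stmt5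
open FourierTransform

/-- the character `t ↦ exp (2 π i t)` -/
def E (t : ℝ) : ℂ := Complex.exp (((2 * Real.pi * t : ℝ) : ℂ) * Complex.I)

lemma E_add (s t : ℝ) : E (s + t) = E s * E t := by
  unfold E; rw [← Complex.exp_add]; congr 1; push_cast; ring

lemma norm_E (t : ℝ) : ‖E t‖ = 1 := by
  unfold E; exact Complex.norm_exp_ofReal_mul_I _

lemma continuous_E : Continuous E := by unfold E; fun_prop

def J {n : ℕ} (p q : En n → ℂ) (c : ℝ) (ξ η : En n) : ℂ :=
  ∫ u, ∫ v, p u * q v * E (c * ⟪u, v⟫ + ⟪u, ξ⟫ + ⟪v, η⟫)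

lemma integrable_J {n : ℕ} {p q : En n → ℂ} (hp : Integrable p) (hq : Integrable q) (c : ℝ)
    (ξ η : En n) : Integrable (fun z : En n × En n => p z.1 * q z.2 *
      E (c * ⟪z.1, z.2⟫ + ⟪z.1, ξ⟫ + ⟪z.2, η⟫)) (volume.prod volume) := by
  refine (hp.mul_prod hq).mul_bdd (c := 1) ?_ (Filter.Eventually.of_forall fun z => (norm_E _).le)
  refine Continuous.aestronglyMeasurable ?_
  exact continuous_E.comp (by fun_prop)

lemma J_symm {n : ℕ} {p q : En n → ℂ} (hp : Integrable p) (hq : Integrable q) (c : ℝ)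
    (ξ η : En n) : J p q c ξ η = J q p c η ξ := by
  unfold J
  rw [integral_integral_swap (integrable_J hp hq c ξ η)]
  refine integral_congr_ae (Filter.Eventually.of_forall fun v => ?_)
  refine integral_congr_ae (Filter.Eventually.of_forall fun u => ?_)
  simp only
  rw [real_inner_comm u v, mul_comm (p u)]
  congr 2
  ring

lemma rho_shift {n : ℕ} (c : ℝ) (hc : |c| ≤ 1) (u η : En n) :
    rho n (η + c • u) ≤ 2 ^ n * wt n u * rho n η := by
  have h := wt_add (η + c • u) (-(c • u))
  rw [add_neg_cancel_right, wt_neg] at h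
  have h2 := wt_smul_le c hc u
  unfold rho
  rw [inv_le_iff_one_le_mul₀ (wt_pos _), mul_comm, ← mul_assoc, ← div_eq_mul_inv,
    le_div_iff₀ (wt_pos _), one_mul]
  refine h.trans ?_
  have := wt_pos (η + c • u)
  calc _ ≤ 2 ^ n * wt n (η + c • u) * wt n u := by gcongr
    _ = _ := by ring

lemma J_bound1 {n : ℕ} (ψ1 ψ2 : SchwartzMap (En n) ℂ) : ∃ C : ℝ, 0 ≤ C ∧
    ∀ c : ℝ, |c| ≤ 1 → ∀ ξ η : En n, ‖J ψ1 ψ2 c ξ η‖ ≤ C * rho n η ^ 2 := by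
  obtain ⟨C1, hC1, h1⟩ := schwartz_decay ψ1 3
  obtain ⟨C2, hC2, h2⟩ := schwartz_decay (𝓕⁻ ψ2) 2
  have hR : 0 ≤ ∫ x, rho n x := integral_nonneg fun x => (rho_pos x).le
  refine ⟨C1 * C2 * (2 ^ n) ^ 2 * ∫ x, rho n x, by positivity, fun c hc ξ η => ?_⟩
  have inner_eq : ∀ u : En n, ∫ v, ψ1 u * ψ2 v * E (c * ⟪u, v⟫ + ⟪u, ξ⟫ + ⟪v, η⟫)
      = ψ1 u * E ⟪u, ξ⟫ * (𝓕⁻ ψ2) (η + c • u) := by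
    intro u
    rw [SchwartzMap.fourierInv_coe, Real.fourierInv_eq', ← integral_const_mul]
    refine integral_congr_ae (Filter.Eventually.of_forall fun v => ?_)
    simp only [smul_eq_mul]
    change _ = _ * _ * (E _ * _)
    rw [show c * ⟪u, v⟫ + ⟪u, ξ⟫ + ⟪v, η⟫ = ⟪u, ξ⟫ + ⟪v, η + c • u⟫ by
      rw [inner_add_right, inner_smul_right, real_inner_comm u v]; ring, E_add]
    ring
  unfold J
  simp_rw [inner_eq]
  have hb : ∀ u, ‖ψ1 u * E ⟪u, ξ⟫ * (𝓕⁻ ψ2) (η + c • u)‖ ≤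
      (C1 * C2 * (2 ^ n) ^ 2 * rho n η ^ 2) * rho n u := by
    intro u
    rw [norm_mul, norm_mul, norm_E, mul_one]
    have r1 := rho_shift c hc u η
    have e1 : rho n u * wt n u = 1 := inv_mul_cancel₀ (wt_pos u).ne'
    have := rho_pos u
    have := rho_pos (η + c • u)
    calc _ ≤ (C1 * rho n u ^ 3) * (C2 * rho n (η + c • u) ^ 2) := by
          gcongr
          · exact h1 u
          · exact h2 _
      _ ≤ (C1 * rho n u ^ 3) * (C2 * (2 ^ n * wt n u * rho n η) ^ 2) := by gcongr
      _ = (C1 * C2 * (2 ^ n) ^ 2 * rho n η ^ 2) * rho n u * (rho n u * wt n u) ^ 2 := by ring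
      _ = _ := by rw [e1]; ring
  refine (norm_integral_le_of_norm_le (integrable_rho.const_mul _)
    (Filter.Eventually.of_forall hb)).trans (le_of_eq ?_)
  rw [integral_const_mul]; ring

lemma J_bound {n : ℕ} (ψ1 ψ2 : SchwartzMap (En n) ℂ) : ∃ C : ℝ, 0 ≤ C ∧
    ∀ c : ℝ, |c| ≤ 1 → ∀ ξ η : En n, ‖J ψ1 ψ2 c ξ η‖ ≤ C * rho n ξ * rho n η := by
  obtain ⟨C1, hC1, h1⟩ := J_bound1 ψ1 ψ2
  obtain ⟨C2, hC2, h2⟩ := J_bound1 ψ2 ψ1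
  refine ⟨max C1 C2, le_max_of_le_left hC1, fun c hc ξ η => ?_⟩
  have a1 := h1 c hc ξ η
  have a2 := h2 c hc η ξ
  rw [← J_symm ψ1.integrable ψ2.integrable] at a2
  have r1 := rho_pos ξ
  have r2 := rho_pos η
  have hm : 0 ≤ max C1 C2 := le_max_of_le_left hC1
  refine le_of_sq_le_sq ?_ (by positivity)
  calc ‖J ψ1 ψ2 c ξ η‖ ^ 2 = ‖J ψ1 ψ2 c ξ η‖ * ‖J ψ1 ψ2 c ξ η‖ := sq _
    _ ≤ (max C1 C2 * rho n η ^ 2) * (max C1 C2 * rho n ξ ^ 2) := by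
        gcongr
        · exact a1.trans (by gcongr; exact le_max_left _ _)
        · exact a2.trans (by gcongr; exact le_max_right _ _)
    _ = _ := by ring

lemma change_var {n : ℕ} (L : ℝ) (hL : 0 < L) (a : En n) {V : Type*} [NormedAddCommGroup V]
    [NormedSpace ℝ V] (H : En n → V) :
    ∫ x, H (L • x - a) = (L ^ n)⁻¹ • ∫ x, H x := by
  have := Measure.integral_comp_smul_of_nonneg (volume : Measure (En n)) (fun x => H (x - a)) L
    (hR := hL.le)
  rw [this, integral_sub_right_eq_self H a]
  simp

lemma J_scale {n : ℕ} (ψ1 ψ2 : En n → ℂ) (L : ℝ) (hL : 0 < L) (k l : En n) (c : ℝ) (ξ η : En n) :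
    ‖J (fun x => ψ1 (L • x - k)) (fun y => ψ2 (L • y - l)) c ξ η‖ =
    (L ^ n)⁻¹ ^ 2 * ‖J ψ1 ψ2 (c * (L⁻¹) ^ 2) (L⁻¹ • ξ + (c * L⁻¹ ^ 2) • l)
      (L⁻¹ • η + (c * L⁻¹ ^ 2) • k)‖ := by
  have hL' := hL.ne'
  have e : ∀ x k : En n, L⁻¹ • ((L • x - k) + k) = x := by
    intro x k; rw [sub_add_cancel, smul_smul, inv_mul_cancel₀ hL', one_smul]
  have s1 : J (fun x => ψ1 (L • x - k)) (fun y => ψ2 (L • y - l)) c ξ η =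
      ∫ x, (fun u => ∫ y, (fun v => ψ1 u * ψ2 v * E (c * ⟪L⁻¹ • (u + k), L⁻¹ • (v + l)⟫ +
        ⟪L⁻¹ • (u + k), ξ⟫ + ⟪L⁻¹ • (v + l), η⟫)) (L • y - l)) (L • x - k) := by
    unfold J
    simp only [e]
  rw [s1, change_var L hL k (fun u => ∫ y, (fun v => ψ1 u * ψ2 v *
    E (c * ⟪L⁻¹ • (u + k), L⁻¹ • (v + l)⟫ +
        ⟪L⁻¹ • (u + k), ξ⟫ + ⟪L⁻¹ • (v + l), η⟫)) (L • y - l))]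
  have s3 : ∀ u : En n, ∫ y, (fun v => ψ1 u * ψ2 v *
    E (c * ⟪L⁻¹ • (u + k), L⁻¹ • (v + l)⟫ +
        ⟪L⁻¹ • (u + k), ξ⟫ + ⟪L⁻¹ • (v + l), η⟫)) (L • y - l) =
      (L ^ n)⁻¹ • ∫ v, ψ1 u * ψ2 v * E (c * ⟪L⁻¹ • (u + k), L⁻¹ • (v + l)⟫ +
        ⟪L⁻¹ • (u + k), ξ⟫ + ⟪L⁻¹ • (v + l), η⟫) :=
    fun u => change_var L hL l (fun v => ψ1 u * ψ2 v *
      E (c * ⟪L⁻¹ • (u + k), L⁻¹ • (v + l)⟫ +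
        ⟪L⁻¹ • (u + k), ξ⟫ + ⟪L⁻¹ • (v + l), η⟫))
  simp_rw [s3]
  rw [integral_smul, norm_smul, norm_smul, Real.norm_of_nonneg (by positivity), ← mul_assoc, ← sq]
  congr 1
  have s2 : ∀ u v : En n, ψ1 u * ψ2 v * E (c * ⟪L⁻¹ • (u + k), L⁻¹ • (v + l)⟫ +
        ⟪L⁻¹ • (u + k), ξ⟫ + ⟪L⁻¹ • (v + l), η⟫) =
      E (c * L⁻¹ ^ 2 * ⟪k, l⟫ + L⁻¹ * ⟪k, ξ⟫ + L⁻¹ * ⟪l, η⟫) * (ψ1 u * ψ2 v *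
      E (c * L⁻¹ ^ 2 * ⟪u, v⟫ + ⟪u, L⁻¹ • ξ + (c * L⁻¹ ^ 2) • l⟫ +
        ⟪v, L⁻¹ • η + (c * L⁻¹ ^ 2) • k⟫)) := by
    intro u v
    rw [mul_left_comm, ← E_add]
    congr 2
    simp only [inner_add_left, inner_add_right, inner_smul_left, inner_smul_right,
      real_inner_comm k v]
    simp
    ring
  simp_rw [s2, integral_const_mul]
  rw [norm_mul, norm_E, one_mul, J]

lemma pars {n : ℕ} {p q F G : En n → ℂ} (hp : Integrable p) (hq : Integrable q)
    (hF : Integrable F) (hG : Integrable G) (c : ℝ) :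
    ∫ x, ∫ y, p x * q y * E (c * ⟪x, y⟫) * (∫ η, F η * E ⟪y, η⟫) * (∫ ξ, G ξ * E ⟪x, ξ⟫)
    = ∫ ξ, ∫ η, G ξ * F η * J p q c ξ η := by
  have hPQ : Integrable (fun z : En n × En n => p z.1 * q z.2 * E (c * ⟪z.1, z.2⟫))
      (volume.prod volume) := by
    have := integrable_J hp hq c 0 0
    simpa using this
  have hGF : Integrable (fun z : En n × En n => G z.1 * F z.2) (volume.prod volume) :=
    hG.mul_prod hF
  have hbig : Integrable (fun w : (En n × En n) × (En n × En n) =>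
      (p w.1.1 * q w.1.2 * E (c * ⟪w.1.1, w.1.2⟫)) * (G w.2.1 * F w.2.2) *
        E (⟪w.1.1, w.2.1⟫ + ⟪w.1.2, w.2.2⟫))
      ((volume.prod volume).prod (volume.prod volume)) := by
    refine (hPQ.mul_prod hGF).mul_bdd (c := 1) ?_
      (Filter.Eventually.of_forall fun z => (norm_E _).le)
    refine Continuous.aestronglyMeasurable ?_
    exact continuous_E.comp (by fun_prop)
  have hin : ∀ z : En n × En n, ∫ w : En n × En n, (p z.1 * q z.2 * E (c * ⟪z.1, z.2⟫)) *
      (G w.1 * F w.2) * E (⟪z.1, w.1⟫ + ⟪z.2, w.2⟫) ∂(volume.prod volume) =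
      p z.1 * q z.2 * E (c * ⟪z.1, z.2⟫) * (∫ η, F η * E ⟪z.2, η⟫) * (∫ ξ, G ξ * E ⟪z.1, ξ⟫) := by
    intro z
    rw [mul_assoc _ (∫ η, F η * E ⟪z.2, η⟫), mul_comm (∫ η, F η * E ⟪z.2, η⟫),
      ← integral_prod_mul, ← integral_const_mul]
    refine integral_congr_ae (Filter.Eventually.of_forall fun w => ?_)
    simp only [E_add]; ring
  have hout : ∀ w : En n × En n, ∫ z : En n × En n, (p z.1 * q z.2 * E (c * ⟪z.1, z.2⟫)) *
      (G w.1 * F w.2) * E (⟪z.1, w.1⟫ + ⟪z.2, w.2⟫) ∂(volume.prod volume) =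
      G w.1 * F w.2 * J p q c w.1 w.2 := by
    intro w
    rw [J, ← integral_prod _ (integrable_J hp hq c w.1 w.2), ← integral_const_mul]
    refine integral_congr_ae (Filter.Eventually.of_forall fun z => ?_)
    simp only [E_add]; ring
  have h1 := hbig.integral_prod_left
  have h2 := hbig.integral_prod_right
  have hsw := integral_integral_swap (f := fun z w : En n × En n =>
      (p z.1 * q z.2 * E (c * ⟪z.1, z.2⟫)) * (G w.1 * F w.2) *
        E (⟪z.1, w.1⟫ + ⟪z.2, w.2⟫)) hbig
  simp only [hin] at h1 hsw
  simp only [hout] at h2 hsw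
  rw [integral_prod _ h1, integral_prod _ h2] at hsw
  exact hsw

end Stmt5

namespace Stmt5

lemma abstract_sum {H ι : Type*} [NormedAddCommGroup H] [NormedSpace ℂ H] [CompleteSpace H]
    (U : ι → H →L[ℂ] H) (S : Set H) (hS : Dense S) (M N : ℝ) (hM : 0 ≤ M) (hN : 0 ≤ N)
    (h : ∀ f ∈ S, ∃ b : ι → ℝ, (∀ q, 0 ≤ b q) ∧ (∀ F : Finset ι, ∑ q ∈ F, b q ≤ M * ‖f‖ ^ 2) ∧
      ∀ F : Finset ι, ‖∑ q ∈ F, U q f‖ ≤ N * √(∑ q ∈ F, b q)) :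
    ∃ V : H →L[ℂ] H, (∀ f, HasSum (fun q => U q f) (V f)) ∧ ‖V‖ ≤ N * √M := by
  have hK : 0 ≤ N * √M := by positivity
  have unif : ∀ F : Finset ι, ∀ f, ‖∑ q ∈ F, U q f‖ ≤ N * √M * ‖f‖ := by
    intro F f
    have hc : IsClosed {f : H | ‖∑ q ∈ F, U q f‖ ≤ N * √M * ‖f‖} :=
      isClosed_le (by fun_prop) (by fun_prop)
    have hsub : S ⊆ {f : H | ‖∑ q ∈ F, U q f‖ ≤ N * √M * ‖f‖} := by
      intro f hf
      obtain ⟨b, hb0, hb1, hb2⟩ := h f hf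
      refine (hb2 F).trans ?_
      rw [mul_assoc]
      gcongr
      calc √(∑ q ∈ F, b q) ≤ √(M * ‖f‖ ^ 2) := Real.sqrt_le_sqrt (hb1 F)
        _ = √M * ‖f‖ := by rw [Real.sqrt_mul hM, Real.sqrt_sq (norm_nonneg _)]
    exact closure_minimal hsub hc (hS f)
  have summ : ∀ f, Summable (fun q => U q f) := by
    intro f
    rw [summable_iff_vanishing_norm]
    intro ε hε
    obtain ⟨f', hf', hd⟩ := Metric.dense_iff.1 hS f (ε / (2 * (N * √M + 1))) (by positivity)
    rw [Metric.mem_ball, dist_eq_norm] at hf'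
    obtain ⟨b, hb0, hb1, hb2⟩ := h f' hd
    have hbs : Summable b := summable_of_sum_le hb0 hb1
    obtain ⟨s, hs⟩ := summable_iff_vanishing_norm.1 hbs ((ε / (2 * (N + 1))) ^ 2) (by positivity)
    refine ⟨s, fun t ht => ?_⟩
    have h1 := hs t ht
    have hnn : 0 ≤ ∑ q ∈ t, b q := Finset.sum_nonneg fun _ _ => hb0 _
    rw [Real.norm_of_nonneg hnn] at h1
    have h2 : √(∑ q ∈ t, b q) ≤ ε / (2 * (N + 1)) := by
      rw [← Real.sqrt_sq (show 0 ≤ ε / (2 * (N + 1)) by positivity)]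
      exact Real.sqrt_le_sqrt h1.le
    have h3 : ∑ q ∈ t, U q f = ∑ q ∈ t, U q f' + ∑ q ∈ t, U q (f - f') := by
      rw [← Finset.sum_add_distrib]; simp
    rw [h3]
    have e1 : ‖∑ q ∈ t, U q f'‖ ≤ ε / 2 := by
      refine (hb2 t).trans ?_
      calc N * √(∑ q ∈ t, b q) ≤ (N + 1) * (ε / (2 * (N + 1))) := by
            gcongr; linarith
        _ = ε / 2 := by field_simp
    have e2 : ‖∑ q ∈ t, U q (f - f')‖ < ε / 2 := by
      refine (unif t _).trans_lt ?_
      rw [norm_sub_rev] at hf'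
      calc N * √M * ‖f - f'‖ ≤ (N * √M + 1) * ‖f - f'‖ := by
              gcongr; linarith
        _ < (N * √M + 1) * (ε / (2 * (N * √M + 1))) := by gcongr
        _ = ε / 2 := by field_simp
    exact (norm_add_le _ _).trans_lt (by linarith)
  let V0 : H →ₗ[ℂ] H :=
    { toFun := fun f => ∑' q, U q f
      map_add' := fun f g => by
        simp only [map_add]
        exact (summ f).tsum_add (summ g)
      map_smul' := fun c f => by
        simp only [map_smul, RingHom.id_apply]
        exact (summ f).tsum_const_smul c }
  have hV : ∀ f, ‖V0 f‖ ≤ N * √M * ‖f‖ := by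
    intro f
    exact le_of_tendsto (summ f).hasSum.norm (Filter.Eventually.of_forall fun F => unif F f)
  exact ⟨V0.mkContinuous _ hV, fun f => (summ f).hasSum, V0.mkContinuous_norm_le hK hV⟩

end Stmt5

namespace Stmt5
open FourierTransform

def om (n : ℕ) (x : En n) : ℝ := (1 + ‖x‖ ^ 2) ^ (-(n : ℝ))

lemma om_pos {n : ℕ} (x : En n) : 0 < om n x := by unfold om; positivity

lemma om_le {n : ℕ} (x : En n) : om n x ≤ rho n x := by
  unfold om rho
  rw [Real.rpow_neg (by positivity), Real.rpow_natCast]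
  exact inv_anti₀ (wt_pos x) (wt_le x)

lemma om_temp {n : ℕ} (L : ℝ) (a : En n) :
    (fun y : En n => om n (L • y - a)).HasTemperateGrowth :=
  (Function.hasTemperateGrowth_one_add_norm_sq_rpow (En n) (-(n:ℝ))).comp
    (f := fun y : En n => L • y - a) (by fun_prop)

def loc {n : ℕ} (L : ℝ) (a : En n) (f : SchwartzMap (En n) ℂ) : SchwartzMap (En n) ℂ :=
  SchwartzMap.smulLeftCLM ℂ (fun y : En n => om n (L • y - a)) f

lemma loc_apply {n : ℕ} (L : ℝ) (a : En n) (f : SchwartzMap (En n) ℂ) (y : En n) :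
    loc L a f y = (om n (L • y - a) : ℂ) * f y := by
  unfold loc
  rw [SchwartzMap.smulLeftCLM_apply_apply (om_temp L a)]
  simp

def psi {n : ℕ} (Φ : SchwartzMap (En n) ℝ) : SchwartzMap (En n) ℂ :=
  SchwartzMap.smulLeftCLM ℂ (fun y : En n => (1 + ‖y‖ ^ 2) ^ (n:ℝ))
    (SchwartzMap.postcompCLM Complex.ofRealCLM Φ)

lemma psi_apply {n : ℕ} (Φ : SchwartzMap (En n) ℝ) (x : En n) :
    (Φ x : ℂ) = psi Φ x * (om n x : ℂ) := by
  unfold psi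
  rw [SchwartzMap.smulLeftCLM_apply_apply (Function.hasTemperateGrowth_one_add_norm_sq_rpow (En n) (n:ℝ))]
  simp only [SchwartzMap.postcompCLM_apply, Complex.ofRealCLM_apply, om, Complex.real_smul]
  rw [mul_right_comm, ← Complex.ofReal_mul, ← Real.rpow_add (by positivity)]
  simp

def BB {n : ℕ} (f : SchwartzMap (En n) ℂ) (L ε : ℝ) (k l : Fin n → ℤ) : ℝ :=
  ∫ η, ‖(𝓕 (loc L (intVec n l) f)) η‖ ^ 2 * rho n (L⁻¹ • η + ε • intVec n k)

lemma BB_nonneg {n : ℕ} (f : SchwartzMap (En n) ℂ) (L ε : ℝ) (k l : Fin n → ℤ) :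
    0 ≤ BB f L ε k l :=
  integral_nonneg fun η => mul_nonneg (by positivity) (rho_pos _).le

lemma integrable_sq {n : ℕ} (f : SchwartzMap (En n) ℂ) : Integrable (fun x => ‖f x‖ ^ 2) :=
  (f.memLp 2).integrable_norm_pow (by norm_num)

lemma continuous_r {n : ℕ} (L ε : ℝ) (k : En n) :
    Continuous (fun η : En n => rho n (L⁻¹ • η + ε • k)) :=
  continuous_rho.comp (by fun_prop)

lemma integrable_mul_r {n : ℕ} {h : En n → ℝ} (hh : Integrable h) (L ε : ℝ) (k : En n) :
    Integrable (fun η : En n => h η * rho n (L⁻¹ • η + ε • k)) :=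
  hh.mul_bdd (c := 1) (continuous_r L ε k).aestronglyMeasurable
    (Filter.Eventually.of_forall fun η => by
      rw [Real.norm_of_nonneg (rho_pos _).le]; exact rho_le_one _)

lemma rho_neg {n : ℕ} (x : En n) : rho n (-x) = rho n x := by simp [rho, wt_neg]

lemma sum_BB {n : ℕ} (f : SchwartzMap (En n) ℂ) (L ε : ℝ) (h0 : 0 < ε) (h1 : ε ≤ 1)
    (F : Finset ((Fin n → ℤ) × (Fin n → ℤ))) :
    ∑ q ∈ F, BB f L ε q.1 q.2 ≤ (3 * Real.pi / ε) ^ n * (3 * Real.pi) ^ n * ∫ x, ‖f x‖ ^ 2 := by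
  classical
  have hsub : F ⊆ (F.image Prod.fst) ×ˢ (F.image Prod.snd) := by
    intro q hq
    exact Finset.mem_product.2 ⟨Finset.mem_image_of_mem _ hq, Finset.mem_image_of_mem _ hq⟩
  set F1 := F.image Prod.fst
  set F2 := F.image Prod.snd
  have step1 : ∀ l, ∑ k ∈ F1, BB f L ε k l ≤
      (3 * Real.pi / ε) ^ n * ∫ x, ‖loc L (intVec n l) f x‖ ^ 2 := by
    intro l
    unfold BB
    have hi := integrable_sq (𝓕 (loc L (intVec n l) f))
    rw [← integral_finsetSum _ (fun k _ => integrable_mul_r hi L ε (intVec n k)),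
      ← SchwartzMap.integral_norm_sq_fourier, ← integral_const_mul]
    refine integral_mono (integrable_finsetSum _ (fun k _ => integrable_mul_r hi L ε (intVec n k)))
      (hi.const_mul _) (fun η => ?_)
    simp only
    rw [← Finset.mul_sum, mul_comm]
    gcongr
    exact sum_rho ε h0 h1 _ F1
  have step2 : ∑ l ∈ F2, ∫ x, ‖loc L (intVec n l) f x‖ ^ 2 ≤
      (3 * Real.pi) ^ n * ∫ x, ‖f x‖ ^ 2 := by
    rw [← integral_finsetSum _ (fun l _ => integrable_sq _), ← integral_const_mul]
    refine integral_mono (integrable_finsetSum _ (fun k _ => integrable_sq _))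
      ((integrable_sq f).const_mul _) (fun x => ?_)
    simp only
    calc ∑ l ∈ F2, ‖loc L (intVec n l) f x‖ ^ 2
        ≤ ∑ l ∈ F2, rho n (-(L • x) + (1:ℝ) • intVec n l) * ‖f x‖ ^ 2 := by
          refine Finset.sum_le_sum fun l _ => ?_
          rw [loc_apply, norm_mul, mul_pow, Complex.norm_real,
            Real.norm_of_nonneg (om_pos _).le]
          gcongr
          rw [one_smul, ← rho_neg, neg_add, neg_neg, ← sub_eq_add_neg]
          have a := om_le (L • x - intVec n l)
          have b := om_pos (L • x - intVec n l)
          have c := rho_le_one (L • x - intVec n l)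
          nlinarith
      _ = (∑ l ∈ F2, rho n (-(L • x) + (1:ℝ) • intVec n l)) * ‖f x‖ ^ 2 := by
          rw [Finset.sum_mul]
      _ ≤ _ := by
          gcongr
          have := sum_rho (1:ℝ) one_pos le_rfl (-(L • x)) F2
          simpa using this
  calc ∑ q ∈ F, BB f L ε q.1 q.2 ≤ ∑ q ∈ F1 ×ˢ F2, BB f L ε q.1 q.2 :=
        Finset.sum_le_sum_of_subset_of_nonneg hsub (fun _ _ _ => BB_nonneg _ _ _ _ _)
    _ = ∑ l ∈ F2, ∑ k ∈ F1, BB f L ε k l := by rw [Finset.sum_product_right]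
    _ ≤ ∑ l ∈ F2, (3 * Real.pi / ε) ^ n * ∫ x, ‖loc L (intVec n l) f x‖ ^ 2 :=
        Finset.sum_le_sum fun l _ => step1 l
    _ = (3 * Real.pi / ε) ^ n * ∑ l ∈ F2, ∫ x, ‖loc L (intVec n l) f x‖ ^ 2 := by
        rw [Finset.mul_sum]
    _ ≤ (3 * Real.pi / ε) ^ n * ((3 * Real.pi) ^ n * ∫ x, ‖f x‖ ^ 2) := by gcongr
    _ = _ := by ring

lemma integral_r {n : ℕ} (L : ℝ) (hL : 0 < L) (ε : ℝ) (k : En n) :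
    ∫ η : En n, rho n (L⁻¹ • η + ε • k) = L ^ n * ∫ x, rho n x := by
  have := change_var L⁻¹ (inv_pos.2 hL) (-(ε • k)) (rho n)
  simpa [sub_neg_eq_add] using this

lemma integrable_r {n : ℕ} (L : ℝ) (hL : 0 < L) (ε : ℝ) (k : En n) :
    Integrable (fun η : En n => rho n (L⁻¹ • η + ε • k)) :=
  (Integrable.comp_add_right integrable_rho (ε • k)).comp_smul (inv_pos.2 hL).ne'

lemma cs {n : ℕ} (h : SchwartzMap (En n) ℂ) (L : ℝ) (hL : 0 < L) (ε : ℝ) (k : En n) :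
    ∫ η, ‖h η‖ * rho n (L⁻¹ • η + ε • k) ≤
      √(∫ η, ‖h η‖ ^ 2 * rho n (L⁻¹ • η + ε • k)) * √(L ^ n * ∫ x, rho n x) := by
  have i0 := integrable_r L hL ε k
  have i1 := integrable_mul_r h.integrable.norm L ε k
  have i2 := integrable_mul_r (integrable_sq h) L ε k
  rw [← integral_r L hL ε k]
  have hd := discrim_le_zero (a := ∫ η : En n, rho n (L⁻¹ • η + ε • k))
    (b := -2 * ∫ η, ‖h η‖ * rho n (L⁻¹ • η + ε • k))
    (c := ∫ η, ‖h η‖ ^ 2 * rho n (L⁻¹ • η + ε • k)) (by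
      intro t
      have e : (∫ η : En n, rho n (L⁻¹ • η + ε • k)) * (t * t) +
          (-2 * ∫ η, ‖h η‖ * rho n (L⁻¹ • η + ε • k)) * t +
          ∫ η, ‖h η‖ ^ 2 * rho n (L⁻¹ • η + ε • k) =
          ∫ η, (‖h η‖ - t) ^ 2 * rho n (L⁻¹ • η + ε • k) := by
        have i01 : Integrable (fun a : En n => rho n (L⁻¹ • a + ε • k) * (t * t) +
            -2 * (‖h a‖ * rho n (L⁻¹ • a + ε • k)) * t) :=
          (i0.mul_const _).add ((i1.const_mul _).mul_const _)
        rw [← integral_const_mul, ← integral_mul_const, ← integral_mul_const,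
          ← integral_add (i0.mul_const _) ((i1.const_mul _).mul_const _),
          ← integral_add i01 i2]
        refine integral_congr_ae (Filter.Eventually.of_forall fun η => ?_)
        simp only
        ring
      rw [e]
      exact integral_nonneg fun η => mul_nonneg (sq_nonneg _) (rho_pos _).le)
  unfold discrim at hd
  rw [← Real.sqrt_mul (integral_nonneg fun η => mul_nonneg (by positivity) (rho_pos _).le)]
  apply Real.le_sqrt_of_sq_le
  nlinarith

end Stmt5

namespace Stmt5
open FourierTransform

lemma inv_E {n : ℕ} (h : SchwartzMap (En n) ℂ) (y : En n) :
    ∫ η, (𝓕 h) η * E ⟪y, η⟫ = h y := by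
  have e : (𝓕⁻ (𝓕 h)) y = h y := by rw [FourierTransform.fourierInv_fourier_eq]
  rw [← e, SchwartzMap.fourierInv_coe, Real.fourierInv_eq']
  refine integral_congr_ae (Filter.Eventually.of_forall fun v => ?_)
  simp only [E, smul_eq_mul]
  rw [mul_comm, real_inner_comm]

def eps (j : ℕ) : ℝ := (2 * Real.pi)⁻¹ * (((2:ℝ) ^ j)⁻¹) ^ 2

lemma eps_pos (j : ℕ) : 0 < eps j := by unfold eps; positivity

lemma eps_le (j : ℕ) : eps j ≤ 1 := by
  unfold eps
  have h1 : (2 * Real.pi)⁻¹ ≤ 1 := inv_le_one_of_one_le₀ (by linarith [Real.pi_gt_three])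
  have h2 : ((2:ℝ) ^ j)⁻¹ ≤ 1 := inv_le_one_of_one_le₀ (one_le_pow₀ (by norm_num))
  have h3 : (((2:ℝ) ^ j)⁻¹) ^ 2 ≤ 1 := pow_le_one₀ (by positivity) h2
  have h4 : 0 < (2 * Real.pi)⁻¹ := by positivity
  calc _ ≤ (1:ℝ) * 1 := by gcongr
    _ = 1 := one_mul 1

lemma dil_const (n j : ℕ) : (2 : ℝ) ^ ((n * j : ℝ) / 2) * (2 : ℝ) ^ ((n * j : ℝ) / 2) =
    ((2:ℝ) ^ j) ^ n := by
  rw [← Real.rpow_add (by norm_num), add_halves, ← pow_mul, ← Real.rpow_natCast]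
  push_cast
  rw [mul_comm]

lemma exp_E (t : ℝ) : Complex.exp (Complex.I * (t : ℂ)) = E ((2 * Real.pi)⁻¹ * t) := by
  unfold E
  rw [mul_inv_cancel_left₀ (by positivity), mul_comm]

lemma integrable_dil {n : ℕ} (ψ : SchwartzMap (En n) ℂ) (L : ℝ) (hL : 0 < L) (k : En n) :
    Integrable (fun x => ψ (L • x - k)) :=
  (Integrable.comp_sub_right ψ.integrable k).comp_smul hL.ne'

lemma rewrite_form {n : ℕ} (Φ1 Φ2 : SchwartzMap (En n) ℝ) (j : ℕ) (k l : Fin n → ℤ)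
    (f g : SchwartzMap (En n) ℂ) :
    ∫ x, g x * ∫ y : En n, Complex.exp (Complex.I * ((⟪x, y⟫ : ℝ) : ℂ)) *
          ((dil n Φ1 j k x : ℝ) : ℂ) * ((dil n Φ2 j l y : ℝ) : ℂ) * f y =
    ((((2:ℝ) ^ j) ^ n : ℝ) : ℂ) * ∫ ξ, ∫ η, (𝓕 (loc ((2:ℝ) ^ j) (intVec n k) g)) ξ *
      (𝓕 (loc ((2:ℝ) ^ j) (intVec n l) f)) η *
      J (fun x => psi Φ1 ((2:ℝ) ^ j • x - intVec n k)) (fun x => psi Φ2 ((2:ℝ) ^ j • x - intVec n l))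
        (2 * Real.pi)⁻¹ ξ η := by
  have hL : (0:ℝ) < 2 ^ j := by positivity
  rw [← pars (integrable_dil _ _ hL _) (integrable_dil _ _ hL _) (SchwartzMap.integrable _)
    (SchwartzMap.integrable _), ← integral_const_mul]
  refine integral_congr_ae (Filter.Eventually.of_forall fun x => ?_)
  simp only
  rw [← integral_const_mul, ← integral_const_mul]
  refine integral_congr_ae (Filter.Eventually.of_forall fun y => ?_)
  simp only
  rw [inv_E, inv_E, loc_apply, loc_apply, exp_E, ← dil_const]
  unfold dil
  push_cast
  rw [psi_apply, psi_apply]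
  ring

lemma key {n : ℕ} (Φ1 Φ2 : SchwartzMap (En n) ℝ) : ∃ C : ℝ, 0 ≤ C ∧
    ∀ (j : ℕ) (k l : Fin n → ℤ) (f g : SchwartzMap (En n) ℂ),
    ‖∫ x, g x * ∫ y : En n, Complex.exp (Complex.I * ((⟪x, y⟫ : ℝ) : ℂ)) *
          ((dil n Φ1 j k x : ℝ) : ℂ) * ((dil n Φ2 j l y : ℝ) : ℂ) * f y‖ ≤
    C * (√(BB f ((2:ℝ) ^ j) (eps j) k l) * √(BB g ((2:ℝ) ^ j) (eps j) l k)) := by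
  obtain ⟨C, hC, hJ⟩ := J_bound (psi Φ1) (psi Φ2)
  have hR : 0 ≤ ∫ x, rho n x := integral_nonneg fun x => (rho_pos x).le
  refine ⟨C * ∫ x, rho n x, by positivity, fun j k l f g => ?_⟩
  have hL : (0:ℝ) < 2 ^ j := by positivity
  rw [rewrite_form]
  set L : ℝ := 2 ^ j with hLdef
  set G := 𝓕 (loc L (intVec n k) g) with hG
  set F := 𝓕 (loc L (intVec n l) f) with hF
  have hj : ∀ ξ η, ‖J (fun x => psi Φ1 (L • x - intVec n k))
      (fun x => psi Φ2 (L • x - intVec n l)) (2 * Real.pi)⁻¹ ξ η‖ ≤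
      (L ^ n)⁻¹ ^ 2 * (C * rho n (L⁻¹ • ξ + eps j • intVec n l) *
        rho n (L⁻¹ • η + eps j • intVec n k)) := by
    intro ξ η
    rw [J_scale (psi Φ1) (psi Φ2) L hL]
    gcongr
    have h1 : |eps j| ≤ 1 := by rw [abs_of_pos (eps_pos j)]; exact eps_le j
    exact hJ _ h1 _ _
  have i1 := integrable_mul_r G.integrable.norm L (eps j) (intVec n l)
  have i2 := integrable_mul_r F.integrable.norm L (eps j) (intVec n k)
  have inner : ∀ ξ, ‖∫ η, G ξ * F η * J (fun x => psi Φ1 (L • x - intVec n k))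
      (fun x => psi Φ2 (L • x - intVec n l)) (2 * Real.pi)⁻¹ ξ η‖ ≤
      (L ^ n)⁻¹ ^ 2 * C * (∫ η, ‖F η‖ * rho n (L⁻¹ • η + eps j • intVec n k)) *
        (‖G ξ‖ * rho n (L⁻¹ • ξ + eps j • intVec n l)) := by
    intro ξ
    have e : (L ^ n)⁻¹ ^ 2 * C * (∫ η, ‖F η‖ * rho n (L⁻¹ • η + eps j • intVec n k)) *
        (‖G ξ‖ * rho n (L⁻¹ • ξ + eps j • intVec n l)) =
        ∫ η, ((L ^ n)⁻¹ ^ 2 * C * (‖G ξ‖ * rho n (L⁻¹ • ξ + eps j • intVec n l))) *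
          (‖F η‖ * rho n (L⁻¹ • η + eps j • intVec n k)) := by
      rw [integral_const_mul]; ring
    rw [e]
    refine norm_integral_le_of_norm_le (i2.const_mul _) (Filter.Eventually.of_forall fun η => ?_)
    rw [norm_mul, norm_mul]
    calc _ ≤ ‖G ξ‖ * ‖F η‖ * ((L ^ n)⁻¹ ^ 2 * (C * rho n (L⁻¹ • ξ + eps j • intVec n l) *
        rho n (L⁻¹ • η + eps j • intVec n k))) :=
          mul_le_mul_of_nonneg_left (hj ξ η) (by positivity)
      _ = _ := by ring
  have c1 := cs G L hL (eps j) (intVec n l)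
  have c2 := cs F L hL (eps j) (intVec n k)
  have n1 : 0 ≤ ∫ η, ‖F η‖ * rho n (L⁻¹ • η + eps j • intVec n k) :=
    integral_nonneg fun η => mul_nonneg (by positivity) (rho_pos _).le
  have n2 : 0 ≤ ∫ η, ‖G η‖ * rho n (L⁻¹ • η + eps j • intVec n l) :=
    integral_nonneg fun η => mul_nonneg (by positivity) (rho_pos _).le
  have tot : ‖∫ ξ, ∫ η, G ξ * F η * J (fun x => psi Φ1 (L • x - intVec n k))
      (fun x => psi Φ2 (L • x - intVec n l)) (2 * Real.pi)⁻¹ ξ η‖ ≤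
      (L ^ n)⁻¹ ^ 2 * C * (∫ η, ‖F η‖ * rho n (L⁻¹ • η + eps j • intVec n k)) *
        ∫ ξ, (‖G ξ‖ * rho n (L⁻¹ • ξ + eps j • intVec n l)) := by
    rw [← integral_const_mul]
    exact norm_integral_le_of_norm_le (i1.const_mul _) (Filter.Eventually.of_forall inner)
  rw [norm_mul, Complex.norm_real, Real.norm_of_nonneg (by positivity)]
  have hs : √(L ^ n * ∫ x, rho n x) * √(L ^ n * ∫ x, rho n x) = L ^ n * ∫ x, rho n x :=
    Real.mul_self_sqrt (by positivity)
  calc _ ≤ L ^ n * ((L ^ n)⁻¹ ^ 2 * C * (√(BB f L (eps j) k l) * √(L ^ n * ∫ x, rho n x)) *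
        (√(BB g L (eps j) l k) * √(L ^ n * ∫ x, rho n x))) := by
        refine mul_le_mul_of_nonneg_left (tot.trans ?_) (by positivity)
        refine mul_le_mul (mul_le_mul_of_nonneg_left c2 (by positivity)) c1 n2 (by positivity)
    _ = L ^ n * ((L ^ n)⁻¹ ^ 2 * C * (√(BB f L (eps j) k l) * √(BB g L (eps j) l k)) *
        (√(L ^ n * ∫ x, rho n x) * √(L ^ n * ∫ x, rho n x))) := by ring
    _ = _ := by
        rw [hs]
        field_simp

end Stmt5

namespace Stmt5

def cj {n : ℕ} (g : SchwartzMap (En n) ℂ) : SchwartzMap (En n) ℂ :=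
  SchwartzMap.postcompCLM (Complex.conjCLE : ℂ →L[ℝ] ℂ) g

lemma cj_apply {n : ℕ} (g : SchwartzMap (En n) ℂ) (x : En n) :
    cj g x = starRingEnd ℂ (g x) := by
  simp [cj]

lemma norm_sq_toLp {n : ℕ} (f : SchwartzMap (En n) ℂ) :
    ‖f.toLp 2‖ ^ 2 = ∫ x, ‖f x‖ ^ 2 := by
  have h : inner ℂ (f.toLp 2) (f.toLp 2) = ∫ x, ((‖f x‖ ^ 2 : ℝ) : ℂ) := by
    rw [MeasureTheory.L2.inner_def]
    refine integral_congr_ae ?_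
    filter_upwards [f.coeFn_toLp 2] with x hx
    rw [hx, inner_self_eq_norm_sq_to_K]
    simp
  rw [inner_self_eq_norm_sq_to_K, integral_complex_ofReal] at h
  apply Complex.ofReal_injective
  rw [Complex.ofReal_pow]
  exact h

lemma inner_T {n : ℕ} (Φ1 Φ2 : SchwartzMap (En n) ℝ) (j : ℕ) (k l : Fin n → ℤ)
    (T : L2 n →L[ℂ] L2 n)
    (hT : ∀ (f : L2 n), ∀ᵐ x : En n,
        T f x = ∫ y : En n, Complex.exp (Complex.I * ((⟪x, y⟫ : ℝ) : ℂ)) *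
          ((dil n Φ1 j k x : ℝ) : ℂ) * ((dil n Φ2 j l y : ℝ) : ℂ) * f y)
    (f g : SchwartzMap (En n) ℂ) :
    inner ℂ (g.toLp 2) (T (f.toLp 2)) =
      ∫ x, cj g x * ∫ y : En n, Complex.exp (Complex.I * ((⟪x, y⟫ : ℝ) : ℂ)) *
          ((dil n Φ1 j k x : ℝ) : ℂ) * ((dil n Φ2 j l y : ℝ) : ℂ) * f y := by
  rw [MeasureTheory.L2.inner_def]
  refine integral_congr_ae ?_
  filter_upwards [g.coeFn_toLp 2, hT (f.toLp 2)] with x hx hx2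
  rw [hx, hx2, RCLike.inner_apply, cj_apply, mul_comm]
  congr 1
  refine integral_congr_ae ?_
  filter_upwards [f.coeFn_toLp 2] with y hy
  rw [hy]

lemma D_eq (n j : ℕ) : (3 * Real.pi / eps j) ^ n * (3 * Real.pi) ^ n =
    (18 * Real.pi ^ 3) ^ n * (4:ℝ) ^ (j * n) := by
  have h4 : (4:ℝ) ^ (j * n) = (((2:ℝ) ^ j) ^ 2) ^ n := by
    rw [show (4:ℝ) = 2 ^ 2 by norm_num, ← pow_mul, ← pow_mul, ← pow_mul]
    congr 1; ring
  rw [h4, ← mul_pow, ← mul_pow]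
  congr 1
  unfold eps
  have := Real.pi_pos
  field_simp
  norm_num

lemma dense_S (n : ℕ) :
    Dense (Set.range fun f : SchwartzMap (En n) ℂ => (f.toLp 2 : L2 n)) :=
  SchwartzMap.denseRange_toLpCLM (E := En n) (F := ℂ) (p := 2) (by norm_num)

lemma norm_le_of_inner {n : ℕ} (u : L2 n) (K : ℝ) (hK : 0 ≤ K)
    (h : ∀ g : SchwartzMap (En n) ℂ, ‖inner ℂ (g.toLp 2 : L2 n) u‖ ≤ K * ‖(g.toLp 2 : L2 n)‖) :
    ‖u‖ ≤ K := by
  have hc : IsClosed {v : L2 n | ‖inner ℂ v u‖ ≤ K * ‖v‖} :=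
    isClosed_le (by fun_prop) (by fun_prop)
  have hall : ‖inner ℂ u u‖ ≤ K * ‖u‖ := by
    refine closure_minimal ?_ hc (dense_S n u)
    rintro _ ⟨g, rfl⟩
    exact h g
  rw [inner_self_eq_norm_sq_to_K] at hall
  simp only [norm_pow, RCLike.norm_ofReal, abs_norm] at hall
  rcases (norm_nonneg u).eq_or_lt with h0 | h0
  · rw [← h0]; exact hK
  · nlinarith

end Stmt5

/-- For real-valued Schwartz `Φ¹, Φ²`, operators
`T_{j,k,l} f(x) = ∫ e^{i x·y} Φ¹_{j,k}(x) Φ²_{j,l}(y) f(y) dy` and bounded coefficients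
`a_{k,l}`, the series `∑_{(k,l)} a_{k,l} T_{j,k,l} f` converges in `L²` for every `f` and the
resulting operator has norm at most `C · 4^{jn} · sup_{k,l} |a_{k,l}|`, where `C` depends
only on `Φ¹`, `Φ²` and `n`. -/
theorem stmt_5 (n : ℕ) (hn : 1 ≤ n) (Φ1 Φ2 : SchwartzMap (En n) ℝ) :
    ∃ C : ℝ, 0 < C ∧ ∀ (j : ℕ)
      (a : (Fin n → ℤ) × (Fin n → ℤ) → ℂ),
      BddAbove (Set.range fun q => ‖a q‖) →
      ∀ T : (Fin n → ℤ) → (Fin n → ℤ) → L2 n →L[ℂ] L2 n,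
      (∀ (k l : Fin n → ℤ) (f : L2 n), ∀ᵐ x : En n,
        T k l f x = ∫ y : En n, Complex.exp (Complex.I * ((⟪x, y⟫ : ℝ) : ℂ)) *
          ((dil n Φ1 j k x : ℝ) : ℂ) * ((dil n Φ2 j l y : ℝ) : ℂ) * f y) →
      ∃ S : L2 n →L[ℂ] L2 n,
        (∀ f : L2 n, HasSum (fun q : (Fin n → ℤ) × (Fin n → ℤ) => a q • T q.1 q.2 f) (S f)) ∧
        ‖S‖ ≤ C * (4 : ℝ) ^ (j * n) * ⨆ q : (Fin n → ℤ) × (Fin n → ℤ), ‖a q‖ := by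
  obtain ⟨C, hC, hkey⟩ := Stmt5.key Φ1 Φ2
  have hpi := Real.pi_pos
  refine ⟨C * (18 * Real.pi ^ 3) ^ n + 1, by positivity, fun j a ha T hT => ?_⟩
  have hA0 : 0 ≤ ⨆ q : (Fin n → ℤ) × (Fin n → ℤ), ‖a q‖ := Real.iSup_nonneg fun q => norm_nonneg _
  have hA : ∀ q, ‖a q‖ ≤ ⨆ q : (Fin n → ℤ) × (Fin n → ℤ), ‖a q‖ := fun q => le_ciSup ha q
  set A := ⨆ q : (Fin n → ℤ) × (Fin n → ℤ), ‖a q‖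
  have hsum := fun (f : SchwartzMap (En n) ℂ) (F : Finset ((Fin n → ℤ) × (Fin n → ℤ))) =>
    Stmt5.sum_BB f ((2:ℝ) ^ j) (Stmt5.eps j) (Stmt5.eps_pos j) (Stmt5.eps_le j) F
  rw [Stmt5.D_eq] at hsum
  set D : ℝ := (18 * Real.pi ^ 3) ^ n * (4:ℝ) ^ (j * n) with hD
  have hD0 : 0 ≤ D := by positivity
  obtain ⟨V, hV1, hV2⟩ := Stmt5.abstract_sum (fun q : (Fin n → ℤ) × (Fin n → ℤ) => a q • T q.1 q.2)
    _ (Stmt5.dense_S n) D (A * C * √D) hD0 (by positivity) (by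
      rintro _ ⟨f, rfl⟩
      refine ⟨fun q => Stmt5.BB f ((2:ℝ) ^ j) (Stmt5.eps j) q.1 q.2,
        fun q => Stmt5.BB_nonneg _ _ _ _ _, fun F => ?_, fun F => ?_⟩
      · simp only
        rw [Stmt5.norm_sq_toLp]
        exact hsum f F
      · refine Stmt5.norm_le_of_inner _ _ (by positivity) fun g => ?_
        have hsw : ∑ q ∈ F, Stmt5.BB (Stmt5.cj g) ((2:ℝ) ^ j) (Stmt5.eps j) q.2 q.1 ≤
            D * ‖(g.toLp 2 : L2 n)‖ ^ 2 := by
          have h1 := hsum (Stmt5.cj g) (F.map (Equiv.prodComm _ _).toEmbedding)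
          rw [Finset.sum_map] at h1
          rw [Stmt5.norm_sq_toLp]
          simpa [Stmt5.cj_apply] using h1
        have hsq : √(∑ q ∈ F, Stmt5.BB (Stmt5.cj g) ((2:ℝ) ^ j) (Stmt5.eps j) q.2 q.1) ≤
            √D * ‖(g.toLp 2 : L2 n)‖ := by
          refine (Real.sqrt_le_sqrt hsw).trans_eq ?_
          rw [Real.sqrt_mul hD0, Real.sqrt_sq (norm_nonneg _)]
        rw [inner_sum]
        calc _ ≤ ∑ q ∈ F, A * C * (√(Stmt5.BB f ((2:ℝ) ^ j) (Stmt5.eps j) q.1 q.2) *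
              √(Stmt5.BB (Stmt5.cj g) ((2:ℝ) ^ j) (Stmt5.eps j) q.2 q.1)) := by
              refine norm_sum_le_of_le _ fun q _ => ?_
              rw [ContinuousLinearMap.smul_apply, inner_smul_right, norm_mul,
                Stmt5.inner_T Φ1 Φ2 j q.1 q.2 _ (hT q.1 q.2), mul_assoc]
              exact mul_le_mul (hA q) (hkey _ _ _ _ _) (norm_nonneg _) hA0
          _ = A * C * ∑ q ∈ F, (√(Stmt5.BB f ((2:ℝ) ^ j) (Stmt5.eps j) q.1 q.2) *
              √(Stmt5.BB (Stmt5.cj g) ((2:ℝ) ^ j) (Stmt5.eps j) q.2 q.1)) := by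
              rw [Finset.mul_sum]
          _ ≤ A * C * (√(∑ q ∈ F, Stmt5.BB f ((2:ℝ) ^ j) (Stmt5.eps j) q.1 q.2) *
              √(∑ q ∈ F, Stmt5.BB (Stmt5.cj g) ((2:ℝ) ^ j) (Stmt5.eps j) q.2 q.1)) := by
              refine mul_le_mul_of_nonneg_left ?_ (by positivity)
              exact Real.sum_sqrt_mul_sqrt_le F (fun _ => Stmt5.BB_nonneg _ _ _ _ _)
                (fun _ => Stmt5.BB_nonneg _ _ _ _ _)
          _ ≤ A * C * (√(∑ q ∈ F, Stmt5.BB f ((2:ℝ) ^ j) (Stmt5.eps j) q.1 q.2) *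
              (√D * ‖(g.toLp 2 : L2 n)‖)) := by gcongr
          _ = _ := by ring)
  refine ⟨V, fun f => by simpa using hV1 f, hV2.trans ?_⟩
  rw [mul_assoc, Real.mul_self_sqrt hD0, hD]
  have h4 : (0:ℝ) ≤ 4 ^ (j * n) * A := by positivity
  calc _ = C * (18 * Real.pi ^ 3) ^ n * (4 ^ (j * n) * A) := by ring
    _ ≤ (C * (18 * Real.pi ^ 3) ^ n + 1) * (4 ^ (j * n) * A) := by gcongr; linarith
    _ = _ := by ring
end
end
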